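/- There is a universal constant C > 0 such that for all p, q with p* ∈ [2,∞) and q ∈ [2,∞), all positive integers m, n, and every real m×n matrix A = (a_{ij}): E‖G_A‖_{p→q} ≤ C·β(p,q)·( √(p*)·D1 + √q·D2 ) + C·(p* ∨ q)·β(p,q)·max_{i≤m, j≤n} (i+j)^{1/(8(p* ∨ q))} |a_{ij}|, where β(p,q) = (p* ∨ q)^{3/2} if 1/p + 1/q* ≥ 3/2 and β(p,q) = (p* ∨ q)^{11/2} if 1/p + 1/q* < 3/2. -/

import Mathlib

open MeasureTheory ProbabilityTheory
open scoped ENNReal NNReal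

noncomputable section

/-- The `ℓ_r` norm of a finite real vector, `r ∈ [1,∞]`. -/
def lpNorm (r : ℝ≥0∞) {ι : Type*} [Fintype ι] (x : ι → ℝ) : ℝ :=
  if r = ⊤ then ⨆ i, |x i| else (∑ i, |x i| ^ r.toReal) ^ (1 / r.toReal)

/-- The operator norm `‖M‖_{p→q}` expressed via the conjugate exponent `q*`:
the supremum of the bilinear form over `s` in the unit ball of `ℓ_{q*}` and
`t` in the unit ball of `ℓ_p`. -/
def opNorm (p qstar : ℝ≥0∞) {ι κ : Type*} [Fintype ι] [Fintype κ]
    (M : ι → κ → ℝ) : ℝ :=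
  sSup { x : ℝ | ∃ s : ι → ℝ, ∃ t : κ → ℝ,
    lpNorm qstar s ≤ 1 ∧ lpNorm p t ≤ 1 ∧ x = ∑ i, ∑ j, M i j * s i * t j }

/-- The standard Gaussian product measure on `ι → ℝ` (iid `N(0,1)` coordinates). -/
def stdGaussian (ι : Type*) [Fintype ι] : Measure (ι → ℝ) :=
  Measure.pi fun _ => gaussianReal 0 1

/-- `Log x = max 1 (ln x)`; in particular `Log 0 = 1`. -/
def Log (x : ℝ) : ℝ := max 1 (Real.log x)

/-- `E‖G_A‖_{p→q}` for the Gaussian matrix `G_A = (a_{ij} g_{ij})`. -/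
def EopNorm (p qstar : ℝ≥0∞) {m n : ℕ} (A : Fin m → Fin n → ℝ) : ℝ :=
  ∫ g : Fin m × Fin n → ℝ,
    opNorm p qstar (fun i j => A i j * g (i, j)) ∂ stdGaussian (Fin m × Fin n)

/-- `D1 = max_i ‖(a_{ij})_j‖_{p*}`. -/
def D1 (pstar : ℝ≥0∞) {m n : ℕ} (A : Fin m → Fin n → ℝ) : ℝ :=
  ⨆ i, lpNorm pstar (fun j => A i j)

/-- `D2 = max_j ‖(a_{ij})_i‖_q`. -/
def D2 (q : ℝ≥0∞) {m n : ℕ} (A : Fin m → Fin n → ℝ) : ℝ :=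
  ⨆ j, lpNorm q (fun i => A i j)

/-- `max_{i,j} |a_{ij}|`. -/
def maxEntry {m n : ℕ} (A : Fin m → Fin n → ℝ) : ℝ :=
  ⨆ ij : Fin m × Fin n, |A ij.1 ij.2|

/-- `max_{k ≥ 0} inf_{I ⊂ [m]×[n], |I| = k} √(Log k) · max_{(i,j) ∉ I} |a_{ij}|`
(for `k > mn` the term vanishes, so `k` ranges over `0,…,mn`). -/
def Dinf {m n : ℕ} (A : Fin m → Fin n → ℝ) : ℝ :=
  ⨆ k : Fin (m * n + 1),
    ⨅ I : { I : Finset (Fin m × Fin n) // I.card = k.1 },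
      Real.sqrt (Log (k.1 : ℝ)) *
        ⨆ ij : { ij : Fin m × Fin n // ij ∉ I.1 }, |A ij.1.1 ij.1.2|

/-- `E max_{i,j} |a_{ij} g_{ij}|`. -/
def EmaxGauss {m n : ℕ} (A : Fin m → Fin n → ℝ) : ℝ :=
  ∫ g : Fin m × Fin n → ℝ,
    (⨆ ij : Fin m × Fin n, |A ij.1 ij.2 * g ij|) ∂ stdGaussian (Fin m × Fin n)

/-- A convexity-type splitting of the power of a sum in which the coefficient of `v ^ k` does not
depend on `k`. -/
theorem ENNReal.add_pow_le_three_mul (z v : ℝ≥0∞) (k : ℕ) :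
    (z + v) ^ k ≤ 3 * v ^ k + ((k : ℝ≥0∞) + 1) ^ k * z ^ k := by
  rcases Nat.eq_zero_or_pos k with rfl | hk
  · simp
  by_cases h : (k : ℝ≥0∞) * z ≤ v
  · refine le_trans ?_ le_self_add
    have hk0 : (k : ℝ≥0∞) ≠ 0 := by positivity
    have h1 : z + v ≤ ENNReal.ofReal (1 + 1 / k) * v := by
      have : z ≤ (k : ℝ≥0∞)⁻¹ * v := by
        exact (ENNReal.mul_le_iff_le_inv hk0 (by simp)).1 h
      have e : ENNReal.ofReal (1 + 1 / k) = 1 + (k : ℝ≥0∞)⁻¹ := by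
        rw [ENNReal.ofReal_add (by norm_num) (by positivity), one_div,
          ENNReal.ofReal_inv_of_pos (by positivity)]
        simp
      rw [e, add_mul, one_mul, add_comm]
      gcongr
    calc (z + v) ^ k ≤ (ENNReal.ofReal (1 + 1 / k) * v) ^ k := by gcongr
      _ = ENNReal.ofReal ((1 + 1 / k) ^ k) * v ^ k := by
        rw [mul_pow, ENNReal.ofReal_pow (by positivity)]
      _ ≤ 3 * v ^ k := by
        gcongr
        have : ((1 : ℝ) + 1 / k) ^ k ≤ 3 := by
          calc ((1 : ℝ) + 1 / k) ^ k ≤ (Real.exp (1 / k)) ^ k := by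
                gcongr
                linarith [Real.add_one_le_exp (1 / (k : ℝ))]
            _ = Real.exp 1 := by
                rw [← Real.exp_nat_mul]
                congr 1
                field_simp
            _ ≤ 3 := by linarith [Real.exp_one_lt_d9]
        calc ENNReal.ofReal ((1 + 1 / k) ^ k) ≤ ENNReal.ofReal 3 := ENNReal.ofReal_le_ofReal this
          _ = 3 := by simp
  · push Not at h
    refine le_trans ?_ le_add_self
    rw [← mul_pow]
    gcongr
    rw [add_mul, one_mul, add_comm]
    gcongr

/-- Moments of the excess of a sum of independent nonnegative variables over three times its
mean. -/
theorem lintegral_sum_sub_pow_le {Ω ι : Type*} [Fintype ι] {mΩ : MeasurableSpace Ω} {μ : Measure Ω}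
    [IsProbabilityMeasure μ] {Z : ι → Ω → ℝ≥0∞} (hZ : ∀ i, Measurable (Z i)) (hind : iIndepFun Z μ)
    (hfin : ∀ i (k : ℕ), ∫⁻ ω, Z i ω ^ k ∂μ ≠ ⊤) {u : ℝ≥0∞} (hu : 3 * ∑ i, ∫⁻ ω, Z i ω ∂μ ≤ u)
    (hu' : u ≠ ⊤) (k : ℕ) :
    ∫⁻ ω, (∑ i, Z i ω - u) ^ (k + 1) ∂μ
      ≤ ((k : ℝ≥0∞) + 1) ^ k * ∑ i, ∫⁻ ω, Z i ω ^ (k + 1) ∂μ := by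
  classical
  induction k with
  | zero =>
    simp only [zero_add, pow_one, pow_zero, one_mul]
    rw [← lintegral_finsetSum _ fun i _ => hZ i]
    exact lintegral_mono fun ω => tsub_le_self
  | succ k ih =>
    set V : Ω → ℝ≥0∞ := fun ω => ∑ i, Z i ω - u with hV
    have hVm : Measurable V := (Finset.measurable_sum _ fun i _ => hZ i).sub_const _
    have hVfin : ∫⁻ ω, V ω ^ (k + 1) ∂μ ≠ ⊤ := by
      refine ne_top_of_le_ne_top ?_ ih
      refine ENNReal.mul_ne_top (by finiteness) ?_
      exact ENNReal.sum_ne_top.2 fun i _ => hfin i _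
    have hpt : ∀ ω, V ω ^ (k + 1 + 1) + u * V ω ^ (k + 1) ≤ ∑ i, Z i ω * V ω ^ (k + 1) := by
      intro ω
      rw [← Finset.sum_mul]
      rcases le_total u (∑ i, Z i ω) with h | h
      · rw [pow_succ', ← add_mul]
        gcongr
        simp only [hV]
        rw [tsub_add_cancel_of_le h]
      · have : V ω = 0 := tsub_eq_zero_of_le h
        simp [this]
    have hterm : ∀ i, ∫⁻ ω, Z i ω * V ω ^ (k + 1) ∂μ ≤
        3 * (∫⁻ ω, Z i ω ∂μ) * ∫⁻ ω, V ω ^ (k + 1) ∂μ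
          + (((k + 1 : ℕ) : ℝ≥0∞) + 1) ^ (k + 1) * ∫⁻ ω, Z i ω ^ (k + 1 + 1) ∂μ := by
      intro i
      set W : Ω → ℝ≥0∞ := fun ω => (∑ j ∈ Finset.univ.erase i, Z j ω - u) with hW
      have hWm : Measurable W := (Finset.measurable_sum _ fun i _ => hZ i).sub_const _
      have hVW : ∀ ω, V ω ≤ Z i ω + W ω := by
        intro ω
        simp only [hV, hW]
        rw [← Finset.add_sum_erase _ _ (Finset.mem_univ i)]
        exact add_tsub_le_assoc
      have hWV : ∀ ω, W ω ≤ V ω := by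
        intro ω
        simp only [hV, hW]
        gcongr
        exact Finset.subset_univ _
      have hi : IndepFun (Z i) (fun ω => W ω ^ (k + 1)) μ := by
        have h0 := (hind.indepFun_finsetSum_of_notMem hZ (Finset.notMem_erase i Finset.univ)).symm
        have h1 := h0.comp (φ := id) (ψ := fun x : ℝ≥0∞ => (x - u) ^ (k + 1)) measurable_id
          ((measurable_id.sub_const _).pow_const _)
        have e : (fun ω => W ω ^ (k + 1)) =
            (fun x : ℝ≥0∞ => (x - u) ^ (k + 1)) ∘ ∑ j ∈ Finset.univ.erase i, Z j := by
          funext ω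
          change W ω ^ (k + 1) = ((∑ j ∈ Finset.univ.erase i, Z j) ω - u) ^ (k + 1)
          rw [Finset.sum_apply]
        rw [e]
        exact h1
      calc ∫⁻ ω, Z i ω * V ω ^ (k + 1) ∂μ
          ≤ ∫⁻ ω, (3 * (Z i ω * W ω ^ (k + 1))
              + (((k + 1 : ℕ) : ℝ≥0∞) + 1) ^ (k + 1) * Z i ω ^ (k + 1 + 1)) ∂μ := by
            refine lintegral_mono fun ω => ?_
            calc Z i ω * V ω ^ (k + 1) ≤ Z i ω * (Z i ω + W ω) ^ (k + 1) := by
                  gcongr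
                  exact hVW ω
              _ ≤ Z i ω * (3 * W ω ^ (k + 1)
                    + (((k + 1 : ℕ) : ℝ≥0∞) + 1) ^ (k + 1) * Z i ω ^ (k + 1)) := by
                  gcongr
                  exact ENNReal.add_pow_le_three_mul _ _ _
              _ = _ := by ring
        _ = 3 * ((∫⁻ ω, Z i ω ∂μ) * ∫⁻ ω, W ω ^ (k + 1) ∂μ)
              + (((k + 1 : ℕ) : ℝ≥0∞) + 1) ^ (k + 1) * ∫⁻ ω, Z i ω ^ (k + 1 + 1) ∂μ := by
            rw [lintegral_add_left (by fun_prop), lintegral_const_mul _ (by fun_prop),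
              lintegral_const_mul _ (by fun_prop),
              lintegral_mul_eq_lintegral_mul_lintegral_of_indepFun'' (by fun_prop)
                (by fun_prop) hi]
        _ ≤ _ := by
            rw [← mul_assoc]
            gcongr with ω
            exact hWV ω
    have hsum : ∫⁻ ω, V ω ^ (k + 1 + 1) ∂μ + u * ∫⁻ ω, V ω ^ (k + 1) ∂μ ≤
        (((k + 1 : ℕ) : ℝ≥0∞) + 1) ^ (k + 1) * ∑ i, ∫⁻ ω, Z i ω ^ (k + 1 + 1) ∂μ
          + u * ∫⁻ ω, V ω ^ (k + 1) ∂μ := by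
      calc ∫⁻ ω, V ω ^ (k + 1 + 1) ∂μ + u * ∫⁻ ω, V ω ^ (k + 1) ∂μ
          = ∫⁻ ω, (V ω ^ (k + 1 + 1) + u * V ω ^ (k + 1)) ∂μ := by
            rw [lintegral_add_left (by fun_prop), lintegral_const_mul _ (by fun_prop)]
        _ ≤ ∫⁻ ω, ∑ i, Z i ω * V ω ^ (k + 1) ∂μ := lintegral_mono hpt
        _ = ∑ i, ∫⁻ ω, Z i ω * V ω ^ (k + 1) ∂μ :=
            lintegral_finsetSum _ fun i _ => by fun_prop
        _ ≤ ∑ i, (3 * (∫⁻ ω, Z i ω ∂μ) * ∫⁻ ω, V ω ^ (k + 1) ∂μ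
          + (((k + 1 : ℕ) : ℝ≥0∞) + 1) ^ (k + 1) * ∫⁻ ω, Z i ω ^ (k + 1 + 1) ∂μ) :=
            Finset.sum_le_sum fun i _ => hterm i
        _ = (3 * ∑ i, ∫⁻ ω, Z i ω ∂μ) * ∫⁻ ω, V ω ^ (k + 1) ∂μ
          + (((k + 1 : ℕ) : ℝ≥0∞) + 1) ^ (k + 1) * ∑ i, ∫⁻ ω, Z i ω ^ (k + 1 + 1) ∂μ := by
            rw [Finset.sum_add_distrib, ← Finset.sum_mul, ← Finset.mul_sum, ← Finset.mul_sum]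
        _ ≤ _ := by
            rw [add_comm]
            gcongr
    exact (ENNReal.add_le_add_iff_right (ENNReal.mul_ne_top hu' hVfin)).1 hsum

instance {K : Type*} [Fintype K] : IsProbabilityMeasure (_root_.stdGaussian K) := by
  unfold _root_.stdGaussian
  infer_instance

theorem integrable_exp_sum_stdGaussian {K : Type*} [Fintype K] (c : K → ℝ) :
    Integrable (fun g : K → ℝ => Real.exp (∑ k, c k * g k)) (_root_.stdGaussian K) := by
  simp only [Real.exp_sum]
  exact Integrable.fintype_prod (f := fun k x => Real.exp (c k * x))
    fun k => integrable_exp_mul_gaussianReal (c k)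

theorem integral_exp_sum_stdGaussian {K : Type*} [Fintype K] (c : K → ℝ) :
    ∫ g : K → ℝ, Real.exp (∑ k, c k * g k) ∂(_root_.stdGaussian K)
      = Real.exp ((∑ k, c k ^ 2) / 2) := by
  simp only [Real.exp_sum]
  have h := integral_fintype_prod_eq_prod (𝕜 := ℝ) (μ := fun _ : K => gaussianReal 0 1)
    (fun k x => Real.exp (c k * x))
  unfold _root_.stdGaussian
  rw [h, Finset.sum_div, Real.exp_sum]
  refine Finset.prod_congr rfl fun k _ => ?_
  have := congrFun (mgf_id_gaussianReal (μ := 0) (v := 1)) (c k)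
  simpa [mgf] using this

theorem Real.rpow_le_rpow_mul_exp_sub {x y : ℝ} (hx : 0 < x) (hy : 0 ≤ y) :
    y ^ x ≤ x ^ x * Real.exp (y - x) := by
  have h : y ≤ x * Real.exp (y / x - 1) := by
    have := Real.add_one_le_exp (y / x - 1)
    calc y = x * (y / x - 1 + 1) := by field_simp; ring
      _ ≤ _ := by gcongr
  calc y ^ x ≤ (x * Real.exp (y / x - 1)) ^ x := by gcongr
    _ = _ := by
      rw [Real.mul_rpow hx.le (Real.exp_pos _).le, ← Real.exp_mul]
      congr 2
      field_simp

theorem abs_rpow_le_exp_add_exp {x σ : ℝ} (hx : 0 < x) (hσ : 0 < σ) (y : ℝ) :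
    |y| ^ x ≤ (√x * σ) ^ x * Real.exp (-x) *
      (Real.exp (√x / σ * y) + Real.exp (-(√x / σ) * y)) := by
  have hsx : 0 < √x := Real.sqrt_pos.2 hx
  have h := Real.rpow_le_rpow_mul_exp_sub (y := √x / σ * |y|) hx (by positivity)
  have e : |y| ^ x = (σ / √x) ^ x * (√x / σ * |y|) ^ x := by
    rw [← Real.mul_rpow (by positivity) (by positivity)]
    congr 1
    field_simp
  have e2 : (√x * σ) ^ x = (σ / √x) ^ x * x ^ x := by
    rw [← Real.mul_rpow (by positivity) (by positivity)]
    congr 1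
    field_simp
    rw [Real.sq_sqrt hx.le]
  rw [e, e2, mul_assoc, mul_assoc]
  gcongr
  refine h.trans ?_
  gcongr
  rw [sub_eq_neg_add, Real.exp_add]
  gcongr
  rcases abs_cases y with ⟨h, -⟩ | ⟨h, -⟩ <;> rw [h]
  · linarith [Real.exp_pos (-(√x / σ) * y)]
  · rw [mul_neg, ← neg_mul]
    linarith [Real.exp_pos ((√x / σ) * y)]

theorem integrable_abs_sum_rpow_stdGaussian {K : Type*} [Fintype K] (c : K → ℝ) {x : ℝ}
    (hx : 0 < x) :
    Integrable (fun g : K → ℝ => |∑ k, c k * g k| ^ x) (_root_.stdGaussian K) := by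
  have h1 : ∀ t : ℝ, Integrable (fun g : K → ℝ => Real.exp (t * ∑ k, c k * g k))
      (_root_.stdGaussian K) := by
    intro t
    have := integrable_exp_sum_stdGaussian (fun k => t * c k)
    simpa only [Finset.mul_sum, mul_assoc] using this
  refine (((h1 (√x / 1)).add (h1 (-(√x / 1)))).const_mul
    ((√x * 1) ^ x * Real.exp (-x))).mono' ?_ ?_
  · have : Measurable fun g : K → ℝ => |∑ k, c k * g k| ^ x := by fun_prop
    exact this.aestronglyMeasurable
  · refine Filter.Eventually.of_forall fun g => ?_
    rw [Real.norm_of_nonneg (by positivity)]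
    exact abs_rpow_le_exp_add_exp hx one_pos _

theorem integral_abs_sum_rpow_stdGaussian_le {K : Type*} [Fintype K] {c : K → ℝ} {x σ : ℝ}
    (hx : 0 < x) (hσ : 0 < σ) (hc : ∑ k, c k ^ 2 ≤ σ ^ 2) :
    ∫ g : K → ℝ, |∑ k, c k * g k| ^ x ∂(_root_.stdGaussian K) ≤ 2 * (√x * σ) ^ x := by
  have e : ∀ t : ℝ, ∀ g : K → ℝ, t * ∑ k, c k * g k = ∑ k, (t * c k) * g k := by
    intro t g
    rw [Finset.mul_sum]
    exact Finset.sum_congr rfl fun k _ => by ring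
  have h1 : ∀ t : ℝ, Integrable (fun g : K → ℝ => Real.exp (t * ∑ k, c k * g k))
      (_root_.stdGaussian K) := by
    intro t
    simp only [e]
    exact integrable_exp_sum_stdGaussian _
  have h2 : ∀ t : ℝ, ∫ g : K → ℝ, Real.exp (t * ∑ k, c k * g k) ∂(_root_.stdGaussian K)
      = Real.exp (t ^ 2 * (∑ k, c k ^ 2) / 2) := by
    intro t
    simp only [e]
    rw [integral_exp_sum_stdGaussian]
    simp only [mul_pow, Finset.mul_sum]
  have h3 : ∀ t : ℝ, t ^ 2 = x / σ ^ 2 →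
      ∫ g : K → ℝ, Real.exp (t * ∑ k, c k * g k) ∂(_root_.stdGaussian K) ≤ Real.exp (x / 2) := by
    intro t ht
    rw [h2, ht]
    gcongr
    calc x / σ ^ 2 * ∑ k, c k ^ 2 ≤ x / σ ^ 2 * σ ^ 2 := by gcongr
      _ = x := by field_simp
  calc ∫ g : K → ℝ, |∑ k, c k * g k| ^ x ∂(_root_.stdGaussian K)
      ≤ ∫ g : K → ℝ, (√x * σ) ^ x * Real.exp (-x) *
        (Real.exp (√x / σ * ∑ k, c k * g k) + Real.exp (-(√x / σ) * ∑ k, c k * g k))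
          ∂(_root_.stdGaussian K) :=
        integral_mono (integrable_abs_sum_rpow_stdGaussian c hx)
          (((h1 _).add (h1 _)).const_mul _) fun g => abs_rpow_le_exp_add_exp hx hσ _
    _ = (√x * σ) ^ x * Real.exp (-x) *
        (∫ g : K → ℝ, Real.exp (√x / σ * ∑ k, c k * g k) ∂(_root_.stdGaussian K)
        + ∫ g : K → ℝ, Real.exp (-(√x / σ) * ∑ k, c k * g k) ∂(_root_.stdGaussian K)) := by
        rw [integral_const_mul, integral_add (h1 _) (h1 _)]
    _ ≤ (√x * σ) ^ x * Real.exp (-x) * (Real.exp (x / 2) + Real.exp (x / 2)) := by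
        have h4 : (√x / σ) ^ 2 = x / σ ^ 2 := by rw [div_pow, Real.sq_sqrt hx.le]
        have := h3 (√x / σ) h4
        have := h3 (-(√x / σ)) (by rw [neg_sq, h4])
        gcongr
    _ = 2 * (√x * σ) ^ x * (Real.exp (-x) * Real.exp (x / 2)) := by ring
    _ ≤ 2 * (√x * σ) ^ x * 1 := by
        gcongr
        rw [← Real.exp_add, Real.exp_le_one_iff]
        linarith
    _ = _ := mul_one _

theorem Real.le_one_add_rpow {y N : ℝ} (hy : 0 ≤ y) (hN : 1 ≤ N) : y ≤ 1 + y ^ N := by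
  rcases le_total y 1 with h | h
  · linarith [Real.rpow_nonneg hy N]
  · linarith [Real.self_le_rpow_of_one_le h hN]

/-- An integrable majorant of a weighted family of Gaussian linear forms. -/
theorem exists_majorant_gaussian_forms {A K : Type*} [Fintype A] [Fintype K] (c : A → K → ℝ)
    (w : A → ℝ) {τ N S : ℝ} (hτ : 0 < τ) (hN : 1 ≤ N) (hw : ∀ a, 0 < w a)
    (hc : ∀ a, ∑ k, c a k ^ 2 ≤ (τ * w a) ^ 2) (hS : ∑ a, w a ^ N ≤ S) :
    ∃ Q : (K → ℝ) → ℝ, Integrable Q (_root_.stdGaussian K) ∧ (∀ g, 0 ≤ Q g) ∧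
      (∀ g a, |∑ k, c a k * g k| ≤ Q g) ∧
      ∫ g, Q g ∂(_root_.stdGaussian K) ≤ √N * τ * (1 + 2 * S) := by
  have hN0 : 0 < N := by linarith
  have hsN : 0 < √N := Real.sqrt_pos.2 hN0
  have hI : ∀ a, Integrable (fun g : K → ℝ => |∑ k, c a k * g k| ^ N / (√N * τ) ^ N)
      (_root_.stdGaussian K) := fun a =>
    (integrable_abs_sum_rpow_stdGaussian (c a) hN0).div_const _
  have hIs := integrable_finsetSum Finset.univ fun a _ => hI a
  refine ⟨fun g => √N * τ * (1 + ∑ a, |∑ k, c a k * g k| ^ N / (√N * τ) ^ N), ?_, ?_, ?_, ?_⟩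
  · exact ((integrable_const _).add hIs).const_mul _
  · intro g
    positivity
  · intro g a
    have h1 := Real.le_one_add_rpow (y := |∑ k, c a k * g k| / (√N * τ)) (by positivity) hN
    rw [div_le_iff₀ (by positivity), Real.div_rpow (by positivity) (by positivity)] at h1
    rw [mul_comm] at h1
    refine h1.trans ?_
    dsimp only
    gcongr
    exact Finset.single_le_sum (f := fun a => |∑ k, c a k * g k| ^ N / (√N * τ) ^ N)
      (fun a _ => by positivity) (Finset.mem_univ a)
  · rw [integral_const_mul, integral_add (integrable_const _) hIs,
      integral_finsetSum _ fun a _ => hI a]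
    simp only [integral_const, probReal_univ, smul_eq_mul, one_mul]
    gcongr
    calc ∑ a, ∫ g : K → ℝ, |∑ k, c a k * g k| ^ N / (√N * τ) ^ N ∂(_root_.stdGaussian K)
        ≤ ∑ a, 2 * w a ^ N := by
          refine Finset.sum_le_sum fun a _ => ?_
          rw [integral_div, div_le_iff₀ (by positivity)]
          have := hw a
          refine (integral_abs_sum_rpow_stdGaussian_le hN0 (by positivity) (hc a)).trans ?_
          rw [← mul_assoc, Real.mul_rpow (by positivity) this.le]
          apply le_of_eq
          ring
      _ ≤ 2 * S := by
          rw [← Finset.mul_sum]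
          gcongr

theorem lintegral_abs_mul_eval_rpow_le {K : Type*} [Fintype K] (b : ℝ) (k : K) {x : ℝ}
    (hx : 0 < x) :
    ∫⁻ g : K → ℝ, ENNReal.ofReal (|b * g k| ^ x) ∂(_root_.stdGaussian K)
      ≤ ENNReal.ofReal (|b| ^ x * (2 * √x ^ x)) := by
  classical
  have e : ∀ g : K → ℝ, |b * g k| ^ x = |b| ^ x * |∑ l, (Pi.single k 1 : K → ℝ) l * g l| ^ x := by
    intro g
    rw [abs_mul, Real.mul_rpow (by positivity) (by positivity)]
    simp [Pi.single_apply]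
  simp only [e]
  have hI := (integrable_abs_sum_rpow_stdGaussian (Pi.single k 1 : K → ℝ) hx).const_mul (|b| ^ x)
  rw [← ofReal_integral_eq_lintegral_ofReal hI (Filter.Eventually.of_forall fun g => by positivity),
    integral_const_mul]
  refine ENNReal.ofReal_le_ofReal ?_
  gcongr
  have := integral_abs_sum_rpow_stdGaussian_le (c := (Pi.single k 1 : K → ℝ)) hx one_pos
    (by simp [Pi.single_apply])
  simpa using this

theorem sum_sum_mul_rpow_le {ι κ : Type*} [Fintype ι] [Fintype κ] {u : ι → ℝ} {v : κ → ℝ}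
    (hu : ∀ i, 1 ≤ u i) (hv : ∀ j, 1 ≤ v j) (hus : ∑ i, u i ^ (-2 : ℝ) ≤ 2)
    (hvs : ∑ j, v j ^ (-2 : ℝ) ≤ 2) {x : ℝ} (hx : x ≤ -2) :
    ∑ i, ∑ j, (u i * v j) ^ x ≤ 4 := by
  calc ∑ i, ∑ j, (u i * v j) ^ x ≤ ∑ i, ∑ j, u i ^ (-2 : ℝ) * v j ^ (-2 : ℝ) := by
        refine Finset.sum_le_sum fun i _ => Finset.sum_le_sum fun j _ => ?_
        have h1 := hu i
        have h2 := hv j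
        rw [Real.mul_rpow (by linarith) (by linarith)]
        have := Real.rpow_le_rpow_of_exponent_le h1 hx
        have := Real.rpow_le_rpow_of_exponent_le h2 hx
        gcongr
    _ = (∑ i, u i ^ (-2 : ℝ)) * ∑ j, v j ^ (-2 : ℝ) := by rw [Finset.sum_mul_sum]
    _ ≤ 2 * 2 := by
        gcongr
        exact Finset.sum_nonneg fun j _ => Real.rpow_nonneg (by linarith [hv j]) _
    _ = 4 := by norm_num

theorem integral_excess_pow_le {ι K : Type*} [Fintype ι] [Fintype K] {e : ι → K}
    (he : Function.Injective e) (b : ι → ℝ) {q D : ℝ} (hq : 2 ≤ q) (hD0 : 0 ≤ D)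
    (hD : ∑ i, |b i| ^ q ≤ D ^ q) (k : ℕ) :
    Integrable (fun g : K → ℝ =>
        max (∑ i, |b i * g (e i)| ^ q - 6 * (√q * D) ^ q) 0 ^ (k + 1)) (_root_.stdGaussian K) ∧
    ∫ g : K → ℝ, max (∑ i, |b i * g (e i)| ^ q - 6 * (√q * D) ^ q) 0 ^ (k + 1)
      ∂(_root_.stdGaussian K) ≤
      ((k : ℝ) + 1) ^ k * ∑ i, |b i| ^ (q * (k + 1)) * (2 * √(q * (k + 1)) ^ (q * (k + 1))) := by
  have hq0 : 0 < q := by linarith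
  set Z : ι → (K → ℝ) → ℝ≥0∞ := fun i g => ENNReal.ofReal (|b i * g (e i)| ^ q) with hZ
  have hZm : ∀ i, Measurable (Z i) := fun i => by fun_prop
  have hind : iIndepFun Z (_root_.stdGaussian K) := by
    have h0 : iIndepFun (fun (k : K) (g : K → ℝ) => g k) (_root_.stdGaussian K) := by
      unfold _root_.stdGaussian
      exact iIndepFun_pi (X := fun _ x => x) fun _ => aemeasurable_id
    have h1 := (h0.precomp he).comp (fun i x => ENNReal.ofReal (|b i * x| ^ q))
      fun i => by fun_prop
    exact h1
  have hpow : ∀ i (l : ℕ), ∫⁻ g, Z i g ^ l ∂(_root_.stdGaussian K) =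
      ∫⁻ g : K → ℝ, ENNReal.ofReal (|b i * g (e i)| ^ (q * l)) ∂(_root_.stdGaussian K) := by
    intro i l
    refine lintegral_congr fun g => ?_
    rw [hZ, ← ENNReal.ofReal_pow (by positivity), Real.rpow_mul (by positivity), Real.rpow_natCast]
  have hfin : ∀ i (l : ℕ), ∫⁻ g, Z i g ^ l ∂(_root_.stdGaussian K) ≠ ⊤ := by
    intro i l
    rcases Nat.eq_zero_or_pos l with rfl | hl
    · simp
    rw [hpow]
    exact ne_top_of_le_ne_top ENNReal.ofReal_ne_top
      (lintegral_abs_mul_eval_rpow_le _ _ (by positivity))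
  have hu : 3 * ∑ i, ∫⁻ g, Z i g ∂(_root_.stdGaussian K) ≤ ENNReal.ofReal (6 * (√q * D) ^ q) := by
    calc 3 * ∑ i, ∫⁻ g, Z i g ∂(_root_.stdGaussian K)
        ≤ 3 * ∑ i, ENNReal.ofReal (|b i| ^ q * (2 * √q ^ q)) := by
          gcongr with i
          exact lintegral_abs_mul_eval_rpow_le _ _ hq0
      _ = ENNReal.ofReal (3 * ∑ i, (|b i| ^ q * (2 * √q ^ q))) := by
          rw [ENNReal.ofReal_mul (by norm_num), ENNReal.ofReal_sum_of_nonneg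
            (fun i _ => by positivity)]
          simp
      _ ≤ _ := by
          refine ENNReal.ofReal_le_ofReal ?_
          rw [← Finset.sum_mul, Real.mul_rpow (by positivity) hD0]
          have : 0 ≤ √q ^ q := by positivity
          nlinarith
  have key := lintegral_sum_sub_pow_le hZm hind hfin hu ENNReal.ofReal_ne_top k
  have hV : ∀ g : K → ℝ,
      ENNReal.ofReal (max (∑ i, |b i * g (e i)| ^ q - 6 * (√q * D) ^ q) 0 ^ (k + 1))
        = (∑ i, Z i g - ENNReal.ofReal (6 * (√q * D) ^ q)) ^ (k + 1) := by
    intro g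
    rw [ENNReal.ofReal_pow (le_max_right _ _), ENNReal.ofReal_max, ENNReal.ofReal_sub _
      (by positivity), ENNReal.ofReal_sum_of_nonneg (fun i _ => by positivity)]
    simp [hZ]
  have hR : ((k : ℝ≥0∞) + 1) ^ k * ∑ i, ∫⁻ g, Z i g ^ (k + 1) ∂(_root_.stdGaussian K) ≤
      ENNReal.ofReal (((k : ℝ) + 1) ^ k *
        ∑ i, |b i| ^ (q * (k + 1)) * (2 * √(q * (k + 1)) ^ (q * (k + 1)))) := by
    rw [ENNReal.ofReal_mul (by positivity), ENNReal.ofReal_pow (by positivity),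
      ENNReal.ofReal_sum_of_nonneg (fun i _ => by positivity),
      ENNReal.ofReal_add (by positivity) (by norm_num)]
    simp only [ENNReal.ofReal_natCast, ENNReal.ofReal_one]
    gcongr with i
    rw [hpow]
    push_cast
    exact lintegral_abs_mul_eval_rpow_le _ _ (by positivity)
  have hm : Measurable fun g : K → ℝ =>
      max (∑ i, |b i * g (e i)| ^ q - 6 * (√q * D) ^ q) 0 ^ (k + 1) := by fun_prop
  have hnn : ∀ g : K → ℝ,
      0 ≤ max (∑ i, |b i * g (e i)| ^ q - 6 * (√q * D) ^ q) 0 ^ (k + 1) := fun g =>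
    pow_nonneg (le_max_right _ _) _
  have hle := key.trans hR
  simp only [← hV] at hle
  refine ⟨⟨hm.aestronglyMeasurable, ?_⟩, ?_⟩
  · rw [hasFiniteIntegral_iff_ofReal (Filter.Eventually.of_forall hnn)]
    exact hle.trans_lt ENNReal.ofReal_lt_top
  · rw [integral_eq_lintegral_of_nonneg_ae (Filter.Eventually.of_forall hnn)
      hm.aestronglyMeasurable]
    exact ENNReal.toReal_le_of_le_ofReal (by positivity) hle

/-- An integrable majorant of the maximum of the `ℓ_q` norms of the columns of a Gaussian
matrix whose entries decay polynomially. -/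
theorem exists_majorant_column_norms {ι κ K : Type*} [Fintype ι] [Fintype κ] [Fintype K]
    {e : κ → ι → K} (he : ∀ j, Function.Injective (e j)) {b : ι → κ → ℝ} {u : ι → ℝ} {v : κ → ℝ}
    (hu : ∀ i, 1 ≤ u i) (hv : ∀ j, 1 ≤ v j) (hus : ∑ i, u i ^ (-2 : ℝ) ≤ 2)
    (hvs : ∑ j, v j ^ (-2 : ℝ) ≤ 2) {q Λ τ D : ℝ} (hq : 2 ≤ q) (hqΛ : q ≤ Λ) (hτ : 0 < τ)
    (hD0 : 0 ≤ D) (hb : ∀ i j, |b i j| ≤ τ * (u i * v j) ^ (-(1 / (32 * Λ))))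
    (hD : ∀ j, ∑ i, |b i j| ^ q ≤ D ^ q) :
    ∃ Q : (K → ℝ) → ℝ, Integrable Q (_root_.stdGaussian K) ∧ (∀ g, 0 ≤ Q g) ∧
      (∀ g j, (∑ i, |b i j * g (e j i)| ^ q) ^ (1 / q) ≤ Q g) ∧
      ∫ g, Q g ∂(_root_.stdGaussian K) ≤ 6 * √q * D + 585 * Λ * τ := by
  have hq0 : 0 < q := by linarith
  have hΛ0 : 0 < Λ := by linarith
  obtain ⟨k, hk1, hk2⟩ : ∃ k : ℕ, 64 * Λ ≤ q * (k + 1) ∧ q * (k + 1) ≤ 65 * Λ := by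
    refine ⟨⌊64 * Λ / q⌋₊, ?_, ?_⟩
    · have := (Nat.lt_floor_add_one (64 * Λ / q)).le
      rw [div_le_iff₀ hq0] at this
      linarith
    · have := Nat.floor_le (a := 64 * Λ / q) (by positivity)
      rw [le_div_iff₀ hq0] at this
      linarith
  set c : ℝ := 65 * Λ * τ with hc
  have hc0 : 0 < c := by positivity
  set N : ℝ := q * (k + 1) with hN
  have hN1 : 1 ≤ N := by linarith
  set V : κ → (K → ℝ) → ℝ := fun j g =>
    max (∑ i, |b i j * g (e j i)| ^ q - 6 * (√q * D) ^ q) 0 with hV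
  have hV0 : ∀ j g, 0 ≤ V j g := fun j g => le_max_right _ _
  have hI : ∀ j, Integrable (fun g => V j g ^ (k + 1) / c ^ N) (_root_.stdGaussian K) := fun j =>
    (integral_excess_pow_le (he j) (fun i => b i j) hq hD0 (hD j) k).1.div_const _
  have hIs := integrable_finsetSum Finset.univ fun j _ => hI j
  have hI1 : Integrable (fun g => 1 + ∑ j, V j g ^ (k + 1) / c ^ N) (_root_.stdGaussian K) :=
    (integrable_const _).add hIs
  refine ⟨fun g => 6 * √q * D + c * (1 + ∑ j, V j g ^ (k + 1) / c ^ N), ?_, ?_, ?_, ?_⟩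
  · exact (integrable_const _).add (hI1.const_mul _)
  · intro g
    have : ∀ j, 0 ≤ V j g := fun j => hV0 j g
    positivity
  · intro g j
    have hVj := hV0 j g
    have h1 : ∑ i, |b i j * g (e j i)| ^ q ≤ 6 * (√q * D) ^ q + V j g := by
      have : ∑ i, |b i j * g (e j i)| ^ q - 6 * (√q * D) ^ q ≤ V j g := le_max_left _ _
      linarith
    have hq1 : 1 / q ≤ 1 := by
      rw [div_le_one hq0]
      linarith
    have h2 : (6 * (√q * D) ^ q) ^ (1 / q) ≤ 6 * √q * D := by
      rw [Real.mul_rpow (by positivity) (by positivity), ← Real.rpow_mul (by positivity),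
        mul_one_div_cancel hq0.ne', Real.rpow_one, mul_assoc]
      gcongr
      calc (6 : ℝ) ^ (1 / q) ≤ 6 ^ (1 : ℝ) := by
            gcongr
            norm_num
        _ = 6 := Real.rpow_one _
    have h3 : V j g ^ (1 / q) ≤ c * (1 + V j g ^ (k + 1) / c ^ N) := by
      have := Real.le_one_add_rpow (y := V j g ^ (1 / q) / c) (by positivity) hN1
      rw [div_le_iff₀ hc0, Real.div_rpow (by positivity) hc0.le, ← Real.rpow_mul hVj] at this
      rw [mul_comm]
      refine this.trans (le_of_eq ?_)
      have e1 : 1 / q * N = ((k + 1 : ℕ) : ℝ) := by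
        rw [hN]
        push_cast
        field_simp
      rw [e1, Real.rpow_natCast]
    calc (∑ i, |b i j * g (e j i)| ^ q) ^ (1 / q)
        ≤ (6 * (√q * D) ^ q + V j g) ^ (1 / q) := by gcongr
      _ ≤ (6 * (√q * D) ^ q) ^ (1 / q) + V j g ^ (1 / q) :=
          Real.rpow_add_le_add_rpow (by positivity) hVj (by positivity) hq1
      _ ≤ 6 * √q * D + c * (1 + V j g ^ (k + 1) / c ^ N) := add_le_add h2 h3
      _ ≤ _ := by
          dsimp only
          gcongr
          exact Finset.single_le_sum (f := fun j => V j g ^ (k + 1) / c ^ N)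
            (fun j _ => by have := hV0 j g; positivity) (Finset.mem_univ j)
  · dsimp only
    rw [integral_add (integrable_const _) (hI1.const_mul _),
      integral_const_mul c, integral_add (integrable_const _) hIs,
      integral_finsetSum _ fun j _ => hI j]
    simp only [integral_const, probReal_univ, smul_eq_mul, one_mul]
    have hmain : ∑ j, ∫ g, V j g ^ (k + 1) / c ^ N ∂(_root_.stdGaussian K) ≤ 8 := by
      have hk0 : (0 : ℝ) < (k : ℝ) + 1 := by positivity
      have hkk : ((k : ℝ) + 1) ^ k ≤ √(65 * Λ) ^ N := by
        calc ((k : ℝ) + 1) ^ k ≤ ((k : ℝ) + 1) ^ (k + 1) :=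
              pow_le_pow_right₀ (by linarith [(Nat.cast_nonneg k : (0 : ℝ) ≤ k)]) (Nat.le_succ k)
          _ ≤ (√(65 * Λ) ^ (2 : ℝ)) ^ (k + 1) := by
              gcongr
              rw [Real.rpow_ofNat, Real.sq_sqrt (by positivity)]
              nlinarith
          _ = √(65 * Λ) ^ ((2 : ℝ) * (k + 1)) := by
              rw [Real.rpow_mul (by positivity)]
              norm_cast
          _ ≤ √(65 * Λ) ^ N := by
              refine Real.rpow_le_rpow_of_exponent_le ?_ ?_
              · rw [Real.one_le_sqrt]
                linarith
              · rw [hN]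
                gcongr
      have hsN : √N ^ N ≤ √(65 * Λ) ^ N := by gcongr
      have hbN : ∀ i j, |b i j| ^ N ≤ τ ^ N * (u i * v j) ^ (-(N / (32 * Λ))) := by
        intro i j
        have h0 : 0 ≤ u i * v j := mul_nonneg (by linarith [hu i]) (by linarith [hv j])
        calc |b i j| ^ N ≤ (τ * (u i * v j) ^ (-(1 / (32 * Λ)))) ^ N := by
              gcongr
              exact hb i j
          _ = _ := by
              rw [Real.mul_rpow hτ.le (by positivity), ← Real.rpow_mul h0]
              congr 2
              ring
      have hx : -(N / (32 * Λ)) ≤ -2 := by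
        rw [neg_le_neg_iff, le_div_iff₀ (by positivity)]
        linarith
      calc ∑ j, ∫ g, V j g ^ (k + 1) / c ^ N ∂(_root_.stdGaussian K)
          ≤ ∑ j, (((k : ℝ) + 1) ^ k * ∑ i, |b i j| ^ N * (2 * √N ^ N)) / c ^ N := by
            refine Finset.sum_le_sum fun j _ => ?_
            rw [integral_div]
            gcongr
            exact (integral_excess_pow_le (he j) (fun i => b i j) hq hD0 (hD j) k).2
        _ ≤ ∑ j, (√(65 * Λ) ^ N * ∑ i, (τ ^ N * (u i * v j) ^ (-(N / (32 * Λ)))) *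
              (2 * √(65 * Λ) ^ N)) / c ^ N := by
            gcongr with j _ i
            · have h0 : 0 ≤ u i * v j := mul_nonneg (by linarith [hu i]) (by linarith [hv j])
              positivity
            · exact hbN i j
        _ = 2 * ((√(65 * Λ) ^ N * √(65 * Λ) ^ N * τ ^ N) / c ^ N) *
              ∑ i, ∑ j, (u i * v j) ^ (-(N / (32 * Λ))) := by
            rw [Finset.sum_comm, Finset.mul_sum]
            refine Finset.sum_congr rfl fun j _ => ?_
            rw [Finset.mul_sum, Finset.mul_sum, Finset.sum_div]
            exact Finset.sum_congr rfl fun i _ => by ring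
        _ = 2 * ∑ i, ∑ j, (u i * v j) ^ (-(N / (32 * Λ))) := by
            rw [← Real.mul_rpow (by positivity) (by positivity), Real.mul_self_sqrt (by positivity),
              ← Real.mul_rpow (by positivity) (by positivity), ← hc, div_self (by positivity),
              mul_one]
        _ ≤ 2 * 4 := by
            gcongr
            exact sum_sum_mul_rpow_le hu hv hus hvs hx
        _ = 8 := by norm_num
    calc 6 * √q * D + c * (1 + ∑ j, ∫ g, V j g ^ (k + 1) / c ^ N ∂(_root_.stdGaussian K))
        ≤ 6 * √q * D + c * (1 + 8) := by gcongr
      _ = _ := by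
          rw [hc]
          ring

theorem hasDerivAt_gaussianPDFReal_zero_one (x : ℝ) :
    HasDerivAt (gaussianPDFReal 0 1) (-(x * gaussianPDFReal 0 1 x)) x := by
  have e : gaussianPDFReal 0 1 = fun x => (√(2 * Real.pi))⁻¹ * Real.exp (-(x ^ 2 / 2)) := by
    funext x
    simp [gaussianPDFReal, neg_div]
  rw [e]
  have h1 : HasDerivAt (fun x : ℝ => -(x ^ 2 / 2)) (-x) x := by
    refine (((hasDerivAt_id x).pow 2).div_const 2).neg.congr_deriv ?_
    simp
  refine ((h1.exp).const_mul (√(2 * Real.pi))⁻¹).congr_deriv ?_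
  ring

/-- Gaussian integration by parts in one dimension. -/
theorem integral_mul_gaussianReal_eq_integral_deriv {f f' : ℝ → ℝ} {C : ℝ}
    (hf : ∀ x, HasDerivAt f (f' x) x) (hC : ∀ x, |f x| ≤ C) (hC' : ∀ x, |f' x| ≤ C) :
    ∫ x, x * f x ∂(gaussianReal 0 1) = ∫ x, f' x ∂(gaussianReal 0 1) := by
  have hfc : Continuous f := continuous_iff_continuousAt.2 fun x => (hf x).continuousAt
  have hf'm : Measurable f' := by
    have : f' = deriv f := funext fun x => ((hf x).deriv).symm
    rw [this]
    exact measurable_deriv f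
  have hφ := integrable_gaussianPDFReal 0 1
  have hxφ : Integrable (fun x : ℝ => x * gaussianPDFReal 0 1 x) := by
    have := (integrable_mul_exp_neg_mul_sq (b := 1 / 2) (by norm_num)).const_mul
      (√(2 * Real.pi))⁻¹
    refine this.congr (Filter.Eventually.of_forall fun x => ?_)
    simp only [gaussianPDFReal, sub_zero, NNReal.coe_one, mul_one]
    rw [show -(x ^ 2) / 2 = -(1 / 2) * x ^ 2 by ring]
    ring
  rw [integral_gaussianReal_eq_integral_smul one_ne_zero,
    integral_gaussianReal_eq_integral_smul one_ne_zero]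
  have key := integral_mul_deriv_eq_deriv_mul_of_integrable (u := f) (u' := f')
    (v := gaussianPDFReal 0 1) (v' := fun x => -(x * gaussianPDFReal 0 1 x))
    (fun x _ => hf x) (fun x _ => hasDerivAt_gaussianPDFReal_zero_one x)
    (by exact (hxφ.neg).bdd_mul (c := C) hfc.aestronglyMeasurable
          (Filter.Eventually.of_forall hC))
    (by exact hφ.bdd_mul (c := C) hf'm.aestronglyMeasurable (Filter.Eventually.of_forall hC'))
    (by exact hφ.bdd_mul (c := C) hfc.aestronglyMeasurable (Filter.Eventually.of_forall hC))
  simp only [smul_eq_mul]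
  calc ∫ x, gaussianPDFReal 0 1 x * (x * f x)
      = -∫ x, f x * -(x * gaussianPDFReal 0 1 x) := by
        rw [← integral_neg]
        exact integral_congr_ae (Filter.Eventually.of_forall fun x => by ring)
    _ = ∫ x, gaussianPDFReal 0 1 x * f' x := by
        rw [key, neg_neg]
        exact integral_congr_ae (Filter.Eventually.of_forall fun x => by ring)

/-- Resampling one coordinate preserves the standard Gaussian measure. -/
theorem measurePreserving_update_stdGaussian {K : Type*} [Fintype K] [DecidableEq K] (k : K) :
    MeasurePreserving (fun x : (K → ℝ) × ℝ => Function.update x.1 k x.2)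
      ((_root_.stdGaussian K).prod (gaussianReal 0 1)) (_root_.stdGaussian K) := by
  have hm : Measurable fun x : (K → ℝ) × ℝ => Function.update x.1 k x.2 := by
    refine measurable_pi_lambda _ fun i => ?_
    by_cases h : i = k
    · subst h
      simpa using measurable_snd
    · simp only [Function.update_of_ne h]
      fun_prop
  refine ⟨hm, ?_⟩
  symm
  unfold _root_.stdGaussian
  refine Measure.pi_eq fun s hs => ?_
  rw [Measure.map_apply hm (MeasurableSet.univ_pi hs)]
  have e : (fun x : (K → ℝ) × ℝ => Function.update x.1 k x.2) ⁻¹' Set.univ.pi s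
      = Set.univ.pi (Function.update s k Set.univ) ×ˢ s k := by
    ext x
    simp only [Set.mem_preimage, Set.mem_pi, Set.mem_univ, forall_true_left, Set.mem_prod]
    constructor
    · intro h
      refine ⟨fun i => ?_, by simpa using h k⟩
      by_cases hi : i = k
      · subst hi
        simp
      · simpa [Function.update_of_ne hi] using h i
    · rintro ⟨h, h'⟩ i
      by_cases hi : i = k
      · subst hi
        simpa using h'
      · simpa [Function.update_of_ne hi] using h i
  rw [e, Measure.prod_prod, Measure.pi_pi]
  have e2 : ∀ i, gaussianReal 0 1 (Function.update s k Set.univ i)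
      = Function.update (fun i => gaussianReal 0 1 (s i)) k 1 i := by
    intro i
    by_cases hi : i = k
    · subst hi
      simp
    · simp [Function.update_of_ne hi]
  simp only [e2]
  rw [Finset.prod_update_of_mem (Finset.mem_univ k), one_mul,
    ← Finset.prod_sdiff (Finset.subset_univ {k})]
  simp

theorem integrable_eval_stdGaussian {K : Type*} [Fintype K] (k : K) :
    Integrable (fun g : K → ℝ => g k) (_root_.stdGaussian K) := by
  have h : MeasurePreserving (Function.eval k) (_root_.stdGaussian K) (gaussianReal 0 1) :=
    measurePreserving_eval _ k
  exact (h.integrable_comp measurable_id.aestronglyMeasurable).2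
    ((memLp_id_gaussianReal 1).integrable le_rfl)

/-- Gaussian integration by parts in one coordinate. -/
theorem integral_eval_mul_stdGaussian {K : Type*} [Fintype K] [DecidableEq K] (k : K)
    {F F' : (K → ℝ) → ℝ} {C : ℝ} (hFm : Measurable F) (hFm' : Measurable F')
    (hF : ∀ g s, HasDerivAt (fun s => F (Function.update g k s)) (F' (Function.update g k s)) s)
    (hC : ∀ g, |F g| ≤ C) (hC' : ∀ g, |F' g| ≤ C) :
    ∫ g, g k * F g ∂(_root_.stdGaussian K) = ∫ g, F' g ∂(_root_.stdGaussian K) := by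
  have hmp := measurePreserving_update_stdGaussian (K := K) k
  have h1 : Integrable (fun g => g k * F g) (_root_.stdGaussian K) :=
    (integrable_eval_stdGaussian k).mul_bdd (c := C) hFm.aestronglyMeasurable
      (Filter.Eventually.of_forall hC)
  have h2 : Integrable F' (_root_.stdGaussian K) :=
    (integrable_const C).mono' hFm'.aestronglyMeasurable (Filter.Eventually.of_forall hC')
  have h3 : Integrable (fun x : (K → ℝ) × ℝ => Function.update x.1 k x.2 k *
      F (Function.update x.1 k x.2)) ((_root_.stdGaussian K).prod (gaussianReal 0 1)) :=
    (hmp.integrable_comp h1.aestronglyMeasurable).2 h1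
  have h4 : Integrable (fun x : (K → ℝ) × ℝ => F' (Function.update x.1 k x.2))
      ((_root_.stdGaussian K).prod (gaussianReal 0 1)) :=
    (hmp.integrable_comp h2.aestronglyMeasurable).2 h2
  rw [← hmp.map_eq] at h1 h2
  conv_lhs => rw [← hmp.map_eq]
  conv_rhs => rw [← hmp.map_eq]
  rw [integral_map hmp.measurable.aemeasurable h1.aestronglyMeasurable,
    integral_map hmp.measurable.aemeasurable h2.aestronglyMeasurable,
    integral_prod _ h3, integral_prod _ h4]
  refine integral_congr_ae (Filter.Eventually.of_forall fun g => ?_)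
  simp only [Function.update_self]
  exact integral_mul_gaussianReal_eq_integral_deriv (hF g) (fun s => hC _) (fun s => hC' _)

/-- The Gibbs weights `exp z_a / ∑_b exp z_b`. -/
noncomputable def gibbs {A : Type*} [Fintype A] (z : A → ℝ) (a : A) : ℝ :=
  Real.exp (z a) / ∑ b, Real.exp (z b)

section gibbs
variable {A : Type*} [Fintype A]

theorem sum_exp_pos [Nonempty A] (z : A → ℝ) : 0 < ∑ b, Real.exp (z b) :=
  Finset.sum_pos (fun _ _ => Real.exp_pos _) Finset.univ_nonempty

theorem gibbs_nonneg (z : A → ℝ) (a : A) : 0 ≤ gibbs z a := by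
  unfold gibbs
  positivity

theorem sum_gibbs [Nonempty A] (z : A → ℝ) : ∑ a, gibbs z a = 1 := by
  unfold gibbs
  rw [← Finset.sum_div, div_self (sum_exp_pos z).ne']

theorem gibbs_le_one [Nonempty A] (z : A → ℝ) (a : A) : gibbs z a ≤ 1 := by
  rw [← sum_gibbs z]
  exact Finset.single_le_sum (fun a _ => gibbs_nonneg z a) (Finset.mem_univ a)

theorem hasDerivAt_log_sum_exp [Nonempty A] {ζ : ℝ → A → ℝ} {ζ' : A → ℝ} {s : ℝ}
    (h : ∀ a, HasDerivAt (fun s => ζ s a) (ζ' a) s) :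
    HasDerivAt (fun s => Real.log (∑ a, Real.exp (ζ s a))) (∑ a, gibbs (ζ s) a * ζ' a) s := by
  have h1 : HasDerivAt (fun s => ∑ a, Real.exp (ζ s a)) (∑ a, Real.exp (ζ s a) * ζ' a) s :=
    HasDerivAt.fun_sum fun a _ => (h a).exp
  refine (h1.log (sum_exp_pos (ζ s)).ne').congr_deriv ?_
  rw [Finset.sum_div]
  refine Finset.sum_congr rfl fun a _ => ?_
  unfold gibbs
  ring

theorem hasDerivAt_gibbs [Nonempty A] {ζ : ℝ → A → ℝ} {ζ' : A → ℝ} {s : ℝ}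
    (h : ∀ a, HasDerivAt (fun s => ζ s a) (ζ' a) s) (a : A) :
    HasDerivAt (fun s => gibbs (ζ s) a)
      (gibbs (ζ s) a * (ζ' a - ∑ b, gibbs (ζ s) b * ζ' b)) s := by
  have h1 : HasDerivAt (fun s => ∑ a, Real.exp (ζ s a)) (∑ a, Real.exp (ζ s a) * ζ' a) s :=
    HasDerivAt.fun_sum fun a _ => (h a).exp
  have h2 := (h a).exp.fun_div h1 (sum_exp_pos (ζ s)).ne'
  refine h2.congr_deriv ?_
  have h0 := (sum_exp_pos (ζ s)).ne'
  have e : ∑ b, gibbs (ζ s) b * ζ' b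
      = (∑ a, Real.exp (ζ s a) * ζ' a) / ∑ a, Real.exp (ζ s a) := by
    rw [Finset.sum_div]
    refine Finset.sum_congr rfl fun a _ => ?_
    unfold gibbs
    ring
  rw [e]
  unfold gibbs
  field_simp

variable {K : Type*} [Fintype K]

theorem measurable_gibbs_forms (w : A → K → ℝ) (a : A) :
    Measurable fun g : K → ℝ => gibbs (fun a => ∑ k, w a k * g k) a := by
  unfold gibbs
  fun_prop

theorem integral_eval_mul_gibbs [Nonempty A] (w : A → K → ℝ) (a : A) (k : K) :
    ∫ g, g k * gibbs (fun a => ∑ k, w a k * g k) a ∂(_root_.stdGaussian K)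
      = ∫ g, gibbs (fun a => ∑ k, w a k * g k) a *
          (w a k - ∑ b, gibbs (fun a => ∑ k, w a k * g k) b * w b k) ∂(_root_.stdGaussian K) := by
  classical
  have hm := measurable_gibbs_forms w
  refine integral_eval_mul_stdGaussian (F := fun g => gibbs (fun a => ∑ k, w a k * g k) a)
    (F' := fun g => gibbs (fun a => ∑ k, w a k * g k) a *
      (w a k - ∑ b, gibbs (fun a => ∑ k, w a k * g k) b * w b k))
    (C := 1 + |w a k| + ∑ b, |w b k|) k (hm a) (by fun_prop) ?_ ?_ ?_
  · intro g s
    refine hasDerivAt_gibbs (ζ := fun s a => ∑ l, w a l * Function.update g k s l)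
      (ζ' := fun a => w a k) (fun b => ?_) a
    have h1 := hasDerivAt_pi.1 (hasDerivAt_update g k s)
    refine (HasDerivAt.fun_sum (u := Finset.univ) fun l _ => (h1 l).const_mul (w b l)).congr_deriv ?_
    simp [Pi.single_apply]
  · intro g
    rw [abs_of_nonneg (gibbs_nonneg _ _)]
    have := gibbs_le_one (fun a => ∑ k, w a k * g k) a
    have : 0 ≤ ∑ b, |w b k| := by positivity
    linarith [abs_nonneg (w a k)]
  · intro g
    rw [abs_mul, abs_of_nonneg (gibbs_nonneg _ _)]
    have h1 := gibbs_le_one (fun a => ∑ k, w a k * g k) a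
    have h2 : |∑ b, gibbs (fun a => ∑ k, w a k * g k) b * w b k| ≤ ∑ b, |w b k| := by
      refine (Finset.abs_sum_le_sum_abs _ _).trans (Finset.sum_le_sum fun b _ => ?_)
      rw [abs_mul, abs_of_nonneg (gibbs_nonneg _ _)]
      exact mul_le_of_le_one_left (abs_nonneg _) (gibbs_le_one _ _)
    calc _ ≤ 1 * (|w a k| + ∑ b, |w b k|) := by
          gcongr
          exact (abs_sub _ _).trans (by gcongr)
      _ ≤ _ := by linarith

theorem integrable_gibbs_mul_eval [Nonempty A] (w : A → K → ℝ) (a : A) (k : K) :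
    Integrable (fun g => g k * gibbs (fun a => ∑ k, w a k * g k) a) (_root_.stdGaussian K) :=
  (integrable_eval_stdGaussian k).mul_bdd (c := 1)
    (measurable_gibbs_forms w a).aestronglyMeasurable
    (Filter.Eventually.of_forall fun g => by
      rw [Real.norm_of_nonneg (gibbs_nonneg _ _)]
      exact gibbs_le_one _ _)

theorem integral_sum_gibbs_mul_form [Nonempty A] (w d : A → K → ℝ) :
    ∫ g, ∑ a, gibbs (fun a => ∑ k, w a k * g k) a * ∑ k, d a k * g k ∂(_root_.stdGaussian K)
      = ∫ g, (∑ a, gibbs (fun a => ∑ k, w a k * g k) a * ∑ k, d a k * w a k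
        - ∑ a, ∑ b, gibbs (fun a => ∑ k, w a k * g k) a * gibbs (fun a => ∑ k, w a k * g k) b *
            ∑ k, d a k * w b k) ∂(_root_.stdGaussian K) := by
  have hm := measurable_gibbs_forms w
  have hI : ∀ a k, Integrable (fun g => gibbs (fun a => ∑ k, w a k * g k) a *
          (w a k - ∑ b, gibbs (fun a => ∑ k, w a k * g k) b * w b k)) (_root_.stdGaussian K) := by
    intro a k
    refine (integrable_const (|w a k| + ∑ b, |w b k|)).mono' (by fun_prop)
      (Filter.Eventually.of_forall fun g => ?_)
    rw [Real.norm_eq_abs, abs_mul, abs_of_nonneg (gibbs_nonneg _ _)]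
    have h1 := gibbs_le_one (fun a => ∑ k, w a k * g k) a
    have h2 : |∑ b, gibbs (fun a => ∑ k, w a k * g k) b * w b k| ≤ ∑ b, |w b k| := by
      refine (Finset.abs_sum_le_sum_abs _ _).trans (Finset.sum_le_sum fun b _ => ?_)
      rw [abs_mul, abs_of_nonneg (gibbs_nonneg _ _)]
      exact mul_le_of_le_one_left (abs_nonneg _) (gibbs_le_one _ _)
    calc _ ≤ 1 * (|w a k| + ∑ b, |w b k|) := by
          gcongr
          exact (abs_sub _ _).trans (by gcongr)
      _ = _ := one_mul _
  calc ∫ g, ∑ a, gibbs (fun a => ∑ k, w a k * g k) a * ∑ k, d a k * g k ∂(_root_.stdGaussian K)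
      = ∫ g, ∑ a, ∑ k, d a k * (g k * gibbs (fun a => ∑ k, w a k * g k) a)
          ∂(_root_.stdGaussian K) := by
        refine integral_congr_ae (Filter.Eventually.of_forall fun g => ?_)
        refine Finset.sum_congr rfl fun a _ => ?_
        rw [Finset.mul_sum]
        exact Finset.sum_congr rfl fun k _ => by ring
    _ = ∑ a, ∑ k, d a k * ∫ g, g k * gibbs (fun a => ∑ k, w a k * g k) a
          ∂(_root_.stdGaussian K) := by
        rw [integral_finsetSum _ fun a _ => integrable_finsetSum _ fun k _ =>
          (integrable_gibbs_mul_eval w a k).const_mul _]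
        refine Finset.sum_congr rfl fun a _ => ?_
        rw [integral_finsetSum _ fun k _ => (integrable_gibbs_mul_eval w a k).const_mul _]
        exact Finset.sum_congr rfl fun k _ => integral_const_mul _ _
    _ = ∫ g, ∑ a, ∑ k, d a k * (gibbs (fun a => ∑ k, w a k * g k) a *
          (w a k - ∑ b, gibbs (fun a => ∑ k, w a k * g k) b * w b k)) ∂(_root_.stdGaussian K) := by
        rw [integral_finsetSum _ fun a _ => integrable_finsetSum _ fun k _ =>
          (hI a k).const_mul _]
        refine Finset.sum_congr rfl fun a _ => ?_
        rw [integral_finsetSum _ fun k _ => (hI a k).const_mul _]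
        refine Finset.sum_congr rfl fun k _ => ?_
        rw [integral_eval_mul_gibbs, integral_const_mul]
    _ = _ := by
        refine integral_congr_ae (Filter.Eventually.of_forall fun g => ?_)
        dsimp only
        rw [← Finset.sum_sub_distrib]
        refine Finset.sum_congr rfl fun a _ => ?_
        simp only [mul_sub, Finset.sum_sub_distrib, Finset.mul_sum]
        congr 1
        · exact Finset.sum_congr rfl fun k _ => by ring
        · rw [Finset.sum_comm]
          exact Finset.sum_congr rfl fun b _ => Finset.sum_congr rfl fun k _ => by ring

end gibbs

section comparison
variable {A : Type*} [Fintype A] [Nonempty A]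

theorem le_log_sum_exp (z : A → ℝ) (a : A) : z a ≤ Real.log (∑ b, Real.exp (z b)) := by
  rw [Real.le_log_iff_exp_le (sum_exp_pos z)]
  exact Finset.single_le_sum (f := fun b => Real.exp (z b)) (fun b _ => (Real.exp_pos _).le)
    (Finset.mem_univ a)

theorem log_sum_exp_le (z : A → ℝ) {M : ℝ} (h : ∀ a, z a ≤ M) :
    Real.log (∑ b, Real.exp (z b)) ≤ Real.log (Fintype.card A) + M := by
  have hc : (0 : ℝ) < Fintype.card A := by exact_mod_cast Fintype.card_pos
  rw [Real.log_le_iff_le_exp (sum_exp_pos z), Real.exp_add, Real.exp_log hc]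
  calc ∑ b, Real.exp (z b) ≤ ∑ _b : A, Real.exp M := by
        gcongr with b
        exact h b
    _ = _ := by simp

theorem abs_log_sum_exp_le (z : A → ℝ) :
    |Real.log (∑ b, Real.exp (z b))| ≤ Real.log (Fintype.card A) + ∑ a, |z a| := by
  have hs : ∀ a, |z a| ≤ ∑ a, |z a| := fun a =>
    Finset.single_le_sum (f := fun a => |z a|) (fun a _ => abs_nonneg _) (Finset.mem_univ a)
  have h0 : 0 ≤ Real.log (Fintype.card A) := Real.log_natCast_nonneg _
  rw [abs_le]
  refine ⟨?_, log_sum_exp_le z fun a => (le_abs_self _).trans (hs a)⟩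
  obtain ⟨a⟩ := ‹Nonempty A›
  have : Nonempty A := ⟨a⟩
  have h1 := le_log_sum_exp z a
  have h2 := hs a
  have := neg_abs_le (z a)
  linarith

variable {K : Type*} [Fintype K]

theorem integrable_form_stdGaussian (c : K → ℝ) :
    Integrable (fun g : K → ℝ => ∑ k, c k * g k) (_root_.stdGaussian K) :=
  integrable_finsetSum _ fun k _ => (integrable_eval_stdGaussian k).const_mul _

theorem integrable_log_sum_exp_forms (w : A → K → ℝ) :
    Integrable (fun g : K → ℝ => Real.log (∑ a, Real.exp (∑ k, w a k * g k)))
      (_root_.stdGaussian K) := by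
  have h : Integrable (fun g : K → ℝ => Real.log (Fintype.card A) + ∑ a, |∑ k, w a k * g k|)
      (_root_.stdGaussian K) :=
    (integrable_const _).add
      (integrable_finsetSum _ fun a _ => (integrable_form_stdGaussian (w a)).abs)
  have hm : Measurable fun g : K → ℝ => Real.log (∑ a, Real.exp (∑ k, w a k * g k)) := by
    fun_prop
  refine h.mono' hm.aestronglyMeasurable (Filter.Eventually.of_forall fun g => ?_)
  exact abs_log_sum_exp_le _

/-- Smooth form of the Sudakov–Fernique comparison: the free energy is monotone in the
increments. -/
theorem integral_log_sum_exp_le_of_increments {x y : A → K → ℝ}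
    (horth : ∀ a b, ∑ k, x a k * y b k = 0)
    (hinc : ∀ a b, ∑ k, (x a k - x b k) ^ 2 ≤ ∑ k, (y a k - y b k) ^ 2) :
    ∫ g : K → ℝ, Real.log (∑ a, Real.exp (∑ k, x a k * g k)) ∂(_root_.stdGaussian K)
      ≤ ∫ g : K → ℝ, Real.log (∑ a, Real.exp (∑ k, y a k * g k)) ∂(_root_.stdGaussian K) := by
  set w : ℝ → A → K → ℝ := fun t a k => Real.cos t * x a k + Real.sin t * y a k with hw
  set d : ℝ → A → K → ℝ := fun t a k => -Real.sin t * x a k + Real.cos t * y a k with hd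
  set φ : ℝ → ℝ := fun t =>
    ∫ g : K → ℝ, Real.log (∑ a, Real.exp (∑ k, w t a k * g k)) ∂(_root_.stdGaussian K) with hφ
  have hder : ∀ t, HasDerivAt φ (∫ g : K → ℝ, ∑ a, gibbs (fun a => ∑ k, w t a k * g k) a *
      ∑ k, d t a k * g k ∂(_root_.stdGaussian K)) t := by
    intro t
    have hz : ∀ t a (g : K → ℝ), HasDerivAt (fun t => ∑ k, w t a k * g k) (∑ k, d t a k * g k) t := by
      intro t a g
      refine HasDerivAt.fun_sum fun k _ => ?_
      exact (((Real.hasDerivAt_cos t).mul_const (x a k)).add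
        ((Real.hasDerivAt_sin t).mul_const (y a k))).mul_const (g k)
    have hb : Integrable (fun g : K → ℝ => ∑ a, ∑ k, (|x a k| + |y a k|) * |g k|)
        (_root_.stdGaussian K) :=
      integrable_finsetSum _ fun a _ => integrable_finsetSum _ fun k _ =>
        (integrable_eval_stdGaussian k).abs.const_mul _
    refine (hasDerivAt_integral_of_dominated_loc_of_deriv_le (s := Set.univ) Filter.univ_mem
      (Filter.Eventually.of_forall fun t => (integrable_log_sum_exp_forms (w t)).1)
      (integrable_log_sum_exp_forms (w t))
      (F' := fun t g => ∑ a, gibbs (fun a => ∑ k, w t a k * g k) a * ∑ k, d t a k * g k)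
      ?_ ?_ hb ?_).2
    · have := measurable_gibbs_forms (w t)
      have : Measurable fun g : K → ℝ =>
          ∑ a, gibbs (fun a => ∑ k, w t a k * g k) a * ∑ k, d t a k * g k := by fun_prop
      exact this.aestronglyMeasurable
    · refine Filter.Eventually.of_forall fun g t _ => ?_
      refine (norm_sum_le _ _).trans (Finset.sum_le_sum fun a _ => ?_)
      rw [Real.norm_eq_abs, abs_mul, abs_of_nonneg (gibbs_nonneg _ _)]
      calc _ ≤ 1 * ∑ k, |d t a k * g k| := by
            gcongr
            · exact gibbs_le_one _ _
            · exact Finset.abs_sum_le_sum_abs _ _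
        _ ≤ _ := by
            rw [one_mul]
            gcongr with k
            rw [abs_mul]
            gcongr
            refine (abs_add_le _ _).trans ?_
            rw [abs_mul, abs_mul, abs_neg]
            have := Real.abs_sin_le_one t
            have := Real.abs_cos_le_one t
            gcongr
            · exact mul_le_of_le_one_left (abs_nonneg _) ‹_›
            · exact mul_le_of_le_one_left (abs_nonneg _) ‹_›
    · exact Filter.Eventually.of_forall fun g t _ =>
        hasDerivAt_log_sum_exp (ζ := fun t a => ∑ k, w t a k * g k) fun a => hz t a g
  have hmono : MonotoneOn φ (Set.Icc 0 (Real.pi / 2)) := by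
    refine monotoneOn_of_hasDerivWithinAt_nonneg (convex_Icc _ _)
      (fun t _ => (hder t).continuousAt.continuousWithinAt)
      (fun t _ => (hder t).hasDerivWithinAt) fun t ht => ?_
    rw [interior_Icc] at ht
    rw [integral_sum_gibbs_mul_form]
    refine integral_nonneg fun g => ?_
    dsimp only [Pi.zero_apply]
    set p := gibbs (fun a => ∑ k, w t a k * g k) with hp
    have hp0 : ∀ a, 0 ≤ p a := gibbs_nonneg _
    have hp1 : ∑ a, p a = 1 := sum_gibbs _
    set H : A → A → ℝ := fun a b => ∑ k, y a k * y b k - ∑ k, x a k * x b k with hH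
    have hdw : ∀ a b, ∑ k, d t a k * w t b k = Real.sin t * Real.cos t * H a b := by
      intro a b
      have e : ∑ k, d t a k * w t b k = Real.sin t * Real.cos t * H a b
          - Real.sin t ^ 2 * ∑ k, x a k * y b k + Real.cos t ^ 2 * ∑ k, x b k * y a k := by
        simp only [hH, hd, hw, mul_sub, Finset.mul_sum, ← Finset.sum_sub_distrib,
          ← Finset.sum_add_distrib]
        exact Finset.sum_congr rfl fun k _ => by ring
      rw [e, horth, horth]
      ring
    have hHinc : ∀ a b, 0 ≤ H a a + H b b - 2 * H a b := by
      intro a b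
      have e : H a a + H b b - 2 * H a b =
          ∑ k, (y a k - y b k) ^ 2 - ∑ k, (x a k - x b k) ^ 2 := by
        simp only [hH, mul_sub, Finset.mul_sum, ← Finset.sum_sub_distrib,
          ← Finset.sum_add_distrib]
        exact Finset.sum_congr rfl fun k _ => by ring
      rw [e, sub_nonneg]
      exact hinc a b
    simp only [hdw]
    have hsc : 0 ≤ Real.sin t * Real.cos t :=
      mul_nonneg (Real.sin_nonneg_of_nonneg_of_le_pi ht.1.le (by linarith [ht.2, Real.pi_pos]))
        (Real.cos_nonneg_of_neg_pi_div_two_le_of_le (by linarith [ht.1, Real.pi_pos]) ht.2.le)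
    have e : ∑ a, p a * (Real.sin t * Real.cos t * H a a)
        - ∑ a, ∑ b, p a * p b * (Real.sin t * Real.cos t * H a b)
        = Real.sin t * Real.cos t / 2 * ∑ a, ∑ b, p a * p b * (H a a + H b b - 2 * H a b) := by
      have e1 : ∑ a, ∑ b, p a * p b * H a a = ∑ a, p a * H a a := by
        refine Finset.sum_congr rfl fun a _ => ?_
        calc ∑ b, p a * p b * H a a = (p a * H a a) * ∑ b, p b := by
              rw [Finset.mul_sum]
              exact Finset.sum_congr rfl fun b _ => by ring
          _ = _ := by rw [hp1, mul_one]
      have e2 : ∑ a, ∑ b, p a * p b * H b b = ∑ a, p a * H a a := by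
        rw [Finset.sum_comm, ← e1]
        exact Finset.sum_congr rfl fun a _ => Finset.sum_congr rfl fun b _ => by ring
      have e3 : ∑ a, ∑ b, p a * p b * (H a a + H b b - 2 * H a b)
          = ∑ a, ∑ b, p a * p b * H a a + ∑ a, ∑ b, p a * p b * H b b
            - 2 * ∑ a, ∑ b, p a * p b * H a b := by
        simp only [Finset.mul_sum, ← Finset.sum_sub_distrib, ← Finset.sum_add_distrib]
        exact Finset.sum_congr rfl fun a _ => Finset.sum_congr rfl fun b _ => by ring
      have e4 : ∑ a, p a * (Real.sin t * Real.cos t * H a a)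
          = Real.sin t * Real.cos t * ∑ a, p a * H a a := by
        rw [Finset.mul_sum]
        exact Finset.sum_congr rfl fun a _ => by ring
      have e5 : ∑ a, ∑ b, p a * p b * (Real.sin t * Real.cos t * H a b)
          = Real.sin t * Real.cos t * ∑ a, ∑ b, p a * p b * H a b := by
        simp only [Finset.mul_sum]
        exact Finset.sum_congr rfl fun a _ => Finset.sum_congr rfl fun b _ => by ring
      rw [e3, e1, e2, e4, e5]
      ring
    rw [e]
    refine mul_nonneg (by positivity) ?_
    exact Finset.sum_nonneg fun a _ => Finset.sum_nonneg fun b _ =>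
      mul_nonneg (mul_nonneg (hp0 a) (hp0 b)) (hHinc a b)
  have h := hmono (Set.left_mem_Icc.2 (by positivity)) (Set.right_mem_Icc.2 (by positivity))
    (by positivity)
  simpa [hφ, hw] using h

/-- **Sudakov–Fernique comparison** for finite families of Gaussian linear forms. -/
theorem sudakov_fernique {x y : A → K → ℝ} (horth : ∀ a b, ∑ k, x a k * y b k = 0)
    (hinc : ∀ a b, ∑ k, (x a k - x b k) ^ 2 ≤ ∑ k, (y a k - y b k) ^ 2)
    {L U : (K → ℝ) → ℝ} (hL : Integrable L (_root_.stdGaussian K))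
    (hU : Integrable U (_root_.stdGaussian K)) (hLx : ∀ g, ∃ a, L g ≤ ∑ k, x a k * g k)
    (hUy : ∀ g a, ∑ k, y a k * g k ≤ U g) :
    ∫ g, L g ∂(_root_.stdGaussian K) ≤ ∫ g, U g ∂(_root_.stdGaussian K) := by
  have key : ∀ β : ℝ, 0 < β → β * ∫ g, L g ∂(_root_.stdGaussian K) ≤
      Real.log (Fintype.card A) + β * ∫ g, U g ∂(_root_.stdGaussian K) := by
    intro β hβ
    have hform : ∀ (c : A → K → ℝ) a (g : K → ℝ),
        ∑ k, (β * c a k) * g k = β * ∑ k, c a k * g k := by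
      intro c a g
      rw [Finset.mul_sum]
      exact Finset.sum_congr rfl fun k _ => by ring
    have h := integral_log_sum_exp_le_of_increments (x := fun a k => β * x a k)
      (y := fun a k => β * y a k)
      (fun a b => by
        have := horth a b
        calc ∑ k, β * x a k * (β * y b k) = β ^ 2 * ∑ k, x a k * y b k := by
              rw [Finset.mul_sum]
              exact Finset.sum_congr rfl fun k _ => by ring
          _ = 0 := by rw [this, mul_zero])
      (fun a b => by
        have := hinc a b
        have e : ∀ c : A → K → ℝ, ∑ k, (β * c a k - β * c b k) ^ 2
            = β ^ 2 * ∑ k, (c a k - c b k) ^ 2 := by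
          intro c
          rw [Finset.mul_sum]
          exact Finset.sum_congr rfl fun k _ => by ring
        rw [e, e]
        gcongr)
    calc β * ∫ g, L g ∂(_root_.stdGaussian K) = ∫ g, β * L g ∂(_root_.stdGaussian K) :=
          (integral_const_mul _ _).symm
      _ ≤ ∫ g : K → ℝ, Real.log (∑ a, Real.exp (∑ k, (β * x a k) * g k))
            ∂(_root_.stdGaussian K) := by
          refine integral_mono (hL.const_mul _) (integrable_log_sum_exp_forms _) fun g => ?_
          obtain ⟨a, ha⟩ := hLx g
          refine le_trans ?_ (le_log_sum_exp (fun a => ∑ k, (β * x a k) * g k) a)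
          dsimp only
          rw [hform]
          gcongr
      _ ≤ _ := h
      _ ≤ ∫ g, (Real.log (Fintype.card A) + β * U g) ∂(_root_.stdGaussian K) := by
          refine integral_mono (integrable_log_sum_exp_forms _)
            ((integrable_const _).add (hU.const_mul _)) fun g => ?_
          refine log_sum_exp_le _ fun a => ?_
          rw [hform]
          have := hUy g a
          gcongr
      _ = _ := by
          rw [integral_add (integrable_const _) (hU.const_mul _), integral_const_mul]
          simp
  have h0 : 0 ≤ Real.log (Fintype.card A) := Real.log_natCast_nonneg _
  refine le_of_forall_pos_le_add fun ε hε => ?_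
  have hβ : 0 < (Real.log (Fintype.card A) + 1) / ε := by positivity
  have := key _ hβ
  set I := ∫ g, L g ∂(_root_.stdGaussian K)
  set J := ∫ g, U g ∂(_root_.stdGaussian K)
  by_contra! hlt
  have h1 : Real.log (Fintype.card A) + 1 <
      (Real.log (Fintype.card A) + 1) / ε * (I - J) := by
    rw [div_mul_eq_mul_div, lt_div_iff₀ hε]
    gcongr
    linarith
  nlinarith

end comparison

theorem measurePreserving_comp_inl_stdGaussian {X Y : Type*} [Fintype X] [Fintype Y] :
    MeasurePreserving (fun (g : X ⊕ Y → ℝ) x => g (Sum.inl x)) (_root_.stdGaussian (X ⊕ Y))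
      (_root_.stdGaussian X) := by
  unfold _root_.stdGaussian
  exact measurePreserving_fst.comp
    (measurePreserving_sumPiEquivProdPi (fun _ : X ⊕ Y => gaussianReal 0 1))

theorem Real.sum_mul_rpow_le_of_sum_le_one {κ : Type*} [Fintype κ] {w f : κ → ℝ}
    (hw : ∀ j, 0 ≤ w j) (hw1 : ∑ j, w j ≤ 1) (hf : ∀ j, 0 ≤ f j) {p : ℝ} (hp : 1 ≤ p) :
    (∑ j, w j * f j) ^ p ≤ ∑ j, w j * f j ^ p := by
  have hp0 : 0 < p := by linarith
  have hS : 0 ≤ ∑ j, w j * f j ^ p :=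
    Finset.sum_nonneg fun j _ => mul_nonneg (hw j) (Real.rpow_nonneg (hf j) _)
  have h := Real.inner_le_weight_mul_Lp_of_nonneg Finset.univ hp w f hw hf
  have h2 : ∑ j, w j * f j ≤ (∑ j, w j * f j ^ p) ^ p⁻¹ := by
    refine h.trans ?_
    refine mul_le_of_le_one_left (Real.rpow_nonneg hS _) ?_
    refine Real.rpow_le_one (Finset.sum_nonneg fun j _ => hw j) hw1 ?_
    rw [sub_nonneg]
    exact inv_le_one_of_one_le₀ hp
  calc (∑ j, w j * f j) ^ p ≤ ((∑ j, w j * f j ^ p) ^ p⁻¹) ^ p :=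
        Real.rpow_le_rpow (Finset.sum_nonneg fun j _ => mul_nonneg (hw j) (hf j)) h2 hp0.le
    _ = _ := by rw [← Real.rpow_mul hS, inv_mul_cancel₀ hp0.ne', Real.rpow_one]

/-- The form `∑ x_i √(∑ b_ij² y_j²) γ_i` is controlled by the largest weighted column norm. -/
theorem sum_mul_sqrt_mul_le {ι κ : Type*} [Fintype ι] [Fintype κ] {q r : ℝ} (hq : 2 ≤ q)
    (hr : r.HolderConjugate q) {x : ι → ℝ} {y : κ → ℝ} (hx : ∀ i, 0 ≤ x i)
    (hx1 : ∑ i, x i ^ r ≤ 1) (hy1 : ∑ j, y j ^ 2 ≤ 1) {b : ι → κ → ℝ} {γ : ι → ℝ} {M : ℝ}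
    (hM : 0 ≤ M) (h : ∀ j, (∑ i, |b i j * γ i| ^ q) ^ (1 / q) ≤ M) :
    ∑ i, x i * √(∑ j, b i j ^ 2 * y j ^ 2) * γ i ≤ M := by
  have hq0 : 0 < q := by linarith
  have h' : ∀ j, ∑ i, |b i j * γ i| ^ q ≤ M ^ q := by
    intro j
    have h0 : 0 ≤ ∑ i, |b i j * γ i| ^ q := by positivity
    calc ∑ i, |b i j * γ i| ^ q = ((∑ i, |b i j * γ i| ^ q) ^ (1 / q)) ^ q := by
          rw [← Real.rpow_mul h0, one_div_mul_cancel hq0.ne', Real.rpow_one]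
      _ ≤ M ^ q := Real.rpow_le_rpow (Real.rpow_nonneg h0 _) (h j) hq0.le
  have hB : ∀ i, (√(∑ j, b i j ^ 2 * y j ^ 2) * |γ i|) ^ q ≤ ∑ j, y j ^ 2 * |b i j * γ i| ^ q := by
    intro i
    have e1 : (√(∑ j, b i j ^ 2 * y j ^ 2) * |γ i|) ^ q
        = (∑ j, y j ^ 2 * (b i j * γ i) ^ 2) ^ (q / 2) := by
      have h0 : 0 ≤ ∑ j, b i j ^ 2 * y j ^ 2 := by positivity
      have e : ∑ j, y j ^ 2 * (b i j * γ i) ^ 2 = (√(∑ j, b i j ^ 2 * y j ^ 2) * |γ i|) ^ (2 : ℝ) := by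
        rw [Real.rpow_two, mul_pow, Real.sq_sqrt h0, sq_abs, Finset.sum_mul]
        exact Finset.sum_congr rfl fun j _ => by ring
      rw [e, ← Real.rpow_mul (by positivity)]
      congr 1
      ring
    rw [e1]
    refine (Real.sum_mul_rpow_le_of_sum_le_one (fun j => sq_nonneg _) hy1
      (fun j => sq_nonneg _) (by linarith)).trans (le_of_eq ?_)
    refine Finset.sum_congr rfl fun j _ => ?_
    rw [← sq_abs (b i j * γ i), ← Real.rpow_two |b i j * γ i|, ← Real.rpow_mul (abs_nonneg _)]
    congr 2
    ring
  calc ∑ i, x i * √(∑ j, b i j ^ 2 * y j ^ 2) * γ i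
      ≤ ∑ i, x i * (√(∑ j, b i j ^ 2 * y j ^ 2) * |γ i|) := by
        refine Finset.sum_le_sum fun i _ => ?_
        rw [mul_assoc]
        have := hx i
        gcongr
        exact le_abs_self _
    _ ≤ (∑ i, x i ^ r) ^ (1 / r) * (∑ i, (√(∑ j, b i j ^ 2 * y j ^ 2) * |γ i|) ^ q) ^ (1 / q) :=
        Real.inner_le_Lp_mul_Lq_of_nonneg _ hr (fun i _ => hx i) fun i _ => by positivity
    _ ≤ 1 * (M ^ q) ^ (1 / q) := by
        have hxs : 0 ≤ ∑ i, x i ^ r := Finset.sum_nonneg fun i _ => Real.rpow_nonneg (hx i) _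
        gcongr
        · exact Real.rpow_le_one hxs hx1 (one_div_nonneg.2 hr.nonneg)
        · calc ∑ i, (√(∑ j, b i j ^ 2 * y j ^ 2) * |γ i|) ^ q
              ≤ ∑ i, ∑ j, y j ^ 2 * |b i j * γ i| ^ q := Finset.sum_le_sum fun i _ => hB i
            _ = ∑ j, y j ^ 2 * ∑ i, |b i j * γ i| ^ q := by
                rw [Finset.sum_comm]
                exact Finset.sum_congr rfl fun j _ => (Finset.mul_sum _ _ _).symm
            _ ≤ ∑ j, y j ^ 2 * M ^ q := by
                gcongr with j
                exact h' j
            _ = (∑ j, y j ^ 2) * M ^ q := (Finset.sum_mul _ _ _).symm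
            _ ≤ M ^ q := mul_le_of_le_one_left (by positivity) hy1
    _ = M := by rw [one_mul, ← Real.rpow_mul hM, mul_one_div_cancel hq0.ne', Real.rpow_one]

theorem sum_sq_bilinear_sub_le {ι κ : Type*} [Fintype ι] [Fintype κ] (b : ι → κ → ℝ)
    {s s' : ι → ℝ} {t t' : κ → ℝ} (hs : ∀ i, 0 ≤ s i) (hs' : ∀ i, 0 ≤ s' i) (ht : ∀ j, 0 ≤ t j)
    (ht' : ∀ j, 0 ≤ t' j) {θ : κ → ℝ} (hθ : ∀ j, 0 < θ j) :
    ∑ i, ∑ j, (b i j * s i * t j - b i j * s' i * t' j) ^ 2 ≤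
      2 * ∑ i, (s i * √(∑ j, b i j ^ 2 * t j ^ 2) - s' i * √(∑ j, b i j ^ 2 * t' j ^ 2)) ^ 2
      + 2 * ∑ j, (t j * √(∑ i, b i j ^ 2 * s i ^ 2) - t' j * √(∑ i, b i j ^ 2 * s' i ^ 2)) ^ 2
      + ∑ j, θ j * (t j ^ 2 - t' j ^ 2) ^ 2
      + ∑ j, (θ j)⁻¹ * (∑ i, b i j ^ 2 * (s i ^ 2 - s' i ^ 2)) ^ 2 := by
  have aux : ∀ x x' β β' : ℝ, 0 ≤ x → 0 ≤ x' → 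
      (x - x') ^ 2 * (β ^ 2 + β' ^ 2) ≤
        2 * (x * β - x' * β') ^ 2 - (x ^ 2 - x' ^ 2) * (β ^ 2 - β' ^ 2) := by
    intro x x' β β' hx hx'
    nlinarith [mul_nonneg (mul_nonneg hx hx') (sq_nonneg (β - β'))]
  have h1 : ∀ i j, (b i j * s i * t j - b i j * s' i * t' j) ^ 2 ≤
      (s i - s' i) ^ 2 * (b i j ^ 2 * t j ^ 2 + b i j ^ 2 * t' j ^ 2)
      + (t j - t' j) ^ 2 * (b i j ^ 2 * s i ^ 2 + b i j ^ 2 * s' i ^ 2) := by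
    intro i j
    have h2 : (s i * t j - s' i * t' j) ^ 2 ≤
        (s i - s' i) ^ 2 * (t j ^ 2 + t' j ^ 2) + (t j - t' j) ^ 2 * (s i ^ 2 + s' i ^ 2) := by
      nlinarith [sq_nonneg ((s i - s' i) * (t j + t' j) - (s i + s' i) * (t j - t' j)),
        sq_nonneg ((s i - s' i) * (t j - t' j)), sq_nonneg ((s i - s' i) * (t j - t' j))]
    calc (b i j * s i * t j - b i j * s' i * t' j) ^ 2
        = b i j ^ 2 * (s i * t j - s' i * t' j) ^ 2 := by ring
      _ ≤ b i j ^ 2 * ((s i - s' i) ^ 2 * (t j ^ 2 + t' j ^ 2)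
          + (t j - t' j) ^ 2 * (s i ^ 2 + s' i ^ 2)) := by gcongr
      _ = _ := by ring
  have hA : ∑ i, ∑ j, (s i - s' i) ^ 2 * (b i j ^ 2 * t j ^ 2 + b i j ^ 2 * t' j ^ 2) ≤
      2 * ∑ i, (s i * √(∑ j, b i j ^ 2 * t j ^ 2) - s' i * √(∑ j, b i j ^ 2 * t' j ^ 2)) ^ 2
      - ∑ i, ∑ j, b i j ^ 2 * (s i ^ 2 - s' i ^ 2) * (t j ^ 2 - t' j ^ 2) := by
    rw [Finset.mul_sum, ← Finset.sum_sub_distrib]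
    refine Finset.sum_le_sum fun i _ => ?_
    have := aux (s i) (s' i) √(∑ j, b i j ^ 2 * t j ^ 2) √(∑ j, b i j ^ 2 * t' j ^ 2) (hs i) (hs' i)
    rw [Real.sq_sqrt (by positivity), Real.sq_sqrt (by positivity)] at this
    rw [← Finset.mul_sum, Finset.sum_add_distrib]
    refine this.trans (le_of_eq ?_)
    rw [← Finset.sum_sub_distrib, Finset.mul_sum]
    congr 1
    exact Finset.sum_congr rfl fun j _ => by ring
  have hB : ∑ i, ∑ j, (t j - t' j) ^ 2 * (b i j ^ 2 * s i ^ 2 + b i j ^ 2 * s' i ^ 2) ≤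
      2 * ∑ j, (t j * √(∑ i, b i j ^ 2 * s i ^ 2) - t' j * √(∑ i, b i j ^ 2 * s' i ^ 2)) ^ 2
      - ∑ i, ∑ j, b i j ^ 2 * (s i ^ 2 - s' i ^ 2) * (t j ^ 2 - t' j ^ 2) := by
    rw [Finset.sum_comm, Finset.sum_comm (f := fun i j => b i j ^ 2 * (s i ^ 2 - s' i ^ 2) *
      (t j ^ 2 - t' j ^ 2)), Finset.mul_sum, ← Finset.sum_sub_distrib]
    refine Finset.sum_le_sum fun j _ => ?_
    have := aux (t j) (t' j) √(∑ i, b i j ^ 2 * s i ^ 2) √(∑ i, b i j ^ 2 * s' i ^ 2) (ht j) (ht' j)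
    rw [Real.sq_sqrt (by positivity), Real.sq_sqrt (by positivity)] at this
    rw [← Finset.mul_sum, Finset.sum_add_distrib]
    refine this.trans (le_of_eq ?_)
    rw [← Finset.sum_sub_distrib, Finset.mul_sum]
    congr 1
    exact Finset.sum_congr rfl fun i _ => by ring
  have hC : -(2 * ∑ i, ∑ j, b i j ^ 2 * (s i ^ 2 - s' i ^ 2) * (t j ^ 2 - t' j ^ 2)) ≤
      ∑ j, θ j * (t j ^ 2 - t' j ^ 2) ^ 2
      + ∑ j, (θ j)⁻¹ * (∑ i, b i j ^ 2 * (s i ^ 2 - s' i ^ 2)) ^ 2 := by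
    rw [Finset.sum_comm, ← Finset.sum_add_distrib, Finset.mul_sum, ← Finset.sum_neg_distrib]
    refine Finset.sum_le_sum fun j _ => ?_
    rw [← Finset.sum_mul]
    set R := ∑ i, b i j ^ 2 * (s i ^ 2 - s' i ^ 2)
    set w := t j ^ 2 - t' j ^ 2
    have h := hθ j
    have e : θ j * w ^ 2 + (θ j)⁻¹ * R ^ 2 - -(2 * (R * w)) = (θ j)⁻¹ * (θ j * w + R) ^ 2 := by
      field_simp
      ring
    have : 0 ≤ (θ j)⁻¹ * (θ j * w + R) ^ 2 := by positivity
    linarith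
  calc ∑ i, ∑ j, (b i j * s i * t j - b i j * s' i * t' j) ^ 2
      ≤ ∑ i, ∑ j, ((s i - s' i) ^ 2 * (b i j ^ 2 * t j ^ 2 + b i j ^ 2 * t' j ^ 2)
      + (t j - t' j) ^ 2 * (b i j ^ 2 * s i ^ 2 + b i j ^ 2 * s' i ^ 2)) :=
        Finset.sum_le_sum fun i _ => Finset.sum_le_sum fun j _ => h1 i j
    _ = ∑ i, ∑ j, (s i - s' i) ^ 2 * (b i j ^ 2 * t j ^ 2 + b i j ^ 2 * t' j ^ 2)
      + ∑ i, ∑ j, (t j - t' j) ^ 2 * (b i j ^ 2 * s i ^ 2 + b i j ^ 2 * s' i ^ 2) := by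
        simp only [← Finset.sum_add_distrib]
    _ ≤ _ := by linarith

/-- Chevet-type bound for Gaussian bilinear forms on `ℓ_{q*} × ℓ_2` with polynomially decaying
coefficients. -/
theorem integral_gaussian_bilinear_le {ι κ A : Type*} [Fintype ι] [Fintype κ] [Fintype A]
    [Nonempty A] {b : ι → κ → ℝ} {u : ι → ℝ} {v : κ → ℝ}
    (hu : ∀ i, 1 ≤ u i) (hv : ∀ j, 1 ≤ v j) (hus : ∑ i, u i ^ (-2 : ℝ) ≤ 2)
    (hvs : ∑ j, v j ^ (-2 : ℝ) ≤ 2) {q r Λ τ D₁ D₂ : ℝ} (hq : 2 ≤ q) (hqΛ : q ≤ Λ)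
    (hr : r.HolderConjugate q) (hτ : 0 < τ) (hD₁0 : 0 ≤ D₁) (hD₂0 : 0 ≤ D₂)
    (hb : ∀ i j, |b i j| ≤ τ * (u i * v j) ^ (-(1 / (32 * Λ))))
    (hD₁ : ∀ i, ∑ j, |b i j| ^ (2 : ℝ) ≤ D₁ ^ (2 : ℝ)) (hD₂ : ∀ j, ∑ i, |b i j| ^ q ≤ D₂ ^ q)
    {s : A → ι → ℝ} {t : A → κ → ℝ} (hs : ∀ a i, 0 ≤ s a i) (ht : ∀ a j, 0 ≤ t a j)
    (hs1 : ∀ a, ∑ i, s a i ^ r ≤ 1) (ht1 : ∀ a, ∑ j, t a j ^ 2 ≤ 1)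
    {L : (ι × κ → ℝ) → ℝ} (hL : Integrable L (_root_.stdGaussian (ι × κ)))
    (hLx : ∀ g, ∃ a, L g ≤ ∑ i, ∑ j, b i j * s a i * t a j * g (i, j)) :
    ∫ g, L g ∂(_root_.stdGaussian (ι × κ)) ≤ 2000 * Λ * (D₁ + D₂ + τ) := by
  classical
  have hq0 : 0 < q := by linarith
  have hΛ0 : 0 < Λ := by linarith
  have hr1 : 1 < r := hr.lt
  have hr2 : r ≤ 2 := by
    have h := hr.sub_one_mul_conj
    nlinarith
  have hs2 : ∀ a, ∑ i, s a i ^ 2 ≤ 1 := by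
    intro a
    refine le_trans (Finset.sum_le_sum fun i _ => ?_) (hs1 a)
    have h1 : s a i ^ r ≤ 1 :=
      (Finset.single_le_sum (f := fun i => s a i ^ r)
        (fun i _ => Real.rpow_nonneg (hs a i) _) (Finset.mem_univ i)).trans (hs1 a)
    have h2 : s a i ≤ 1 := by
      by_contra! h
      exact absurd h1 (not_le.2 (Real.one_lt_rpow h (by linarith)))
    rw [← Real.rpow_two]
    exact Real.rpow_le_rpow_of_exponent_ge' (hs a i) h2 (by linarith) hr2
  have hu0 : ∀ i, 0 < u i := fun i => by linarith [hu i]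
  have hv0 : ∀ j, 0 < v j := fun j => by linarith [hv j]
  set δ : ℝ := 1 / (32 * Λ) with hδ
  have hδ0 : 0 < δ := by positivity
  set θ : κ → ℝ := fun j => (τ * v j ^ (-δ)) ^ 2 with hθ
  have hθ0 : ∀ j, 0 < θ j := fun j => by
    have := hv0 j
    positivity
  have hbθ : ∀ i j, b i j ^ 2 ≤ θ j * (u i ^ (-δ)) ^ 2 := by
    intro i j
    rw [← sq_abs, hθ, ← mul_pow]
    have := hb i j
    rw [Real.mul_rpow (hu0 i).le (hv0 j).le] at this
    gcongr
    refine this.trans (le_of_eq ?_)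
    ring
  let X : A → (ι × κ) ⊕ (ι ⊕ (κ ⊕ (κ ⊕ κ))) → ℝ := fun a =>
    Sum.elim (fun ij => b ij.1 ij.2 * s a ij.1 * t a ij.2) (fun _ => 0)
  let Y : A → (ι × κ) ⊕ (ι ⊕ (κ ⊕ (κ ⊕ κ))) → ℝ := fun a =>
    Sum.elim (fun _ => 0)
      (Sum.elim (fun i => √2 * (s a i * √(∑ j, b i j ^ 2 * t a j ^ 2)))
        (Sum.elim (fun j => √2 * (t a j * √(∑ i, b i j ^ 2 * s a i ^ 2)))
          (Sum.elim (fun j => √(θ j) * t a j ^ 2)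
            (fun j => (√(θ j))⁻¹ * ∑ i, b i j ^ 2 * s a i ^ 2))))
  have horth : ∀ a a', ∑ k, X a k * Y a' k = 0 := by
    intro a a'
    simp [X, Y, Fintype.sum_sum_type]
  have hinc : ∀ a a', ∑ k, (X a k - X a' k) ^ 2 ≤ ∑ k, (Y a k - Y a' k) ^ 2 := by
    intro a a'
    have h := sum_sq_bilinear_sub_le b (hs a) (hs a') (ht a) (ht a') hθ0
    simp only [X, Y, Fintype.sum_sum_type, Sum.elim_inl, Sum.elim_inr, sub_self, ← mul_sub, mul_pow,
      Real.sq_sqrt (zero_le_two : (0 : ℝ) ≤ 2), Real.sq_sqrt (hθ0 _).le, inv_pow]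
    simp only [ne_eq, OfNat.ofNat_ne_zero, not_false_eq_true, zero_pow, Finset.sum_const_zero,
      add_zero, zero_add, Fintype.sum_prod_type, ← Finset.mul_sum, ← Finset.sum_sub_distrib,
      ← mul_sub]
    linarith
  obtain ⟨Q₁, hQ₁i, hQ₁0, hQ₁, hQ₁I⟩ := exists_majorant_column_norms
    (K := (ι × κ) ⊕ (ι ⊕ (κ ⊕ (κ ⊕ κ)))) (e := fun (_ : κ) i => Sum.inr (Sum.inl i))
    (fun _ => Sum.inr_injective.comp Sum.inl_injective) hu hv hus hvs hq hqΛ hτ hD₂0 hb hD₂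
  obtain ⟨Q₂, hQ₂i, hQ₂0, hQ₂, hQ₂I⟩ := exists_majorant_column_norms
    (K := (ι × κ) ⊕ (ι ⊕ (κ ⊕ (κ ⊕ κ)))) (b := fun j i => b i j)
    (e := fun (_ : ι) j => Sum.inr (Sum.inr (Sum.inl j)))
    (fun _ => Sum.inr_injective.comp (Sum.inr_injective.comp Sum.inl_injective)) hv hu hvs hus
    le_rfl (hq.trans hqΛ) hτ hD₁0 (fun j i => by rw [mul_comm (v j)]; exact hb i j) hD₁
  have hN : (1 : ℝ) ≤ 64 * Λ := by linarith
  have hpow : ∀ x : ℝ, 0 < x → (x ^ (-δ)) ^ (64 * Λ) = x ^ (-2 : ℝ) := by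
    intro x hx
    rw [← Real.rpow_mul hx.le]
    congr 1
    rw [hδ]
    field_simp
    norm_num
  obtain ⟨Q₃, hQ₃i, hQ₃0, hQ₃, hQ₃I⟩ := exists_majorant_gaussian_forms
    (K := (ι × κ) ⊕ (ι ⊕ (κ ⊕ (κ ⊕ κ))))
    (fun (j : κ) => Pi.single (Sum.inr (Sum.inr (Sum.inr (Sum.inl j)))) √(θ j))
    (fun j => v j ^ (-δ)) hτ hN (fun j => Real.rpow_pos_of_pos (hv0 j) _)
    (fun j => by simp [Pi.single_apply, hθ, Real.sq_sqrt (sq_nonneg _)])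
    (by simpa only [hpow _ (hv0 _)] using hvs)
  obtain ⟨Q₄, hQ₄i, hQ₄0, hQ₄, hQ₄I⟩ := exists_majorant_gaussian_forms
    (K := (ι × κ) ⊕ (ι ⊕ (κ ⊕ (κ ⊕ κ)))) (τ := D₁ + τ)
    (fun (i : ι) => Sum.elim (fun _ => 0) (Sum.elim (fun _ => 0) (Sum.elim (fun _ => 0)
      (Sum.elim (fun _ => 0) fun j => (√(θ j))⁻¹ * b i j ^ 2))))
    (fun i => u i ^ (-δ)) (by positivity) hN (fun i => Real.rpow_pos_of_pos (hu0 i) _)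
    (fun i => by
      simp only [Fintype.sum_sum_type, Sum.elim_inl, Sum.elim_inr, ne_eq, OfNat.ofNat_ne_zero,
        not_false_eq_true, zero_pow, Finset.sum_const_zero, zero_add, mul_pow, inv_pow,
        Real.sq_sqrt (hθ0 _).le]
      calc ∑ j, (θ j)⁻¹ * (b i j ^ 2) ^ 2 ≤ ∑ j, (u i ^ (-δ)) ^ 2 * b i j ^ 2 := by
            refine Finset.sum_le_sum fun j _ => ?_
            rw [sq (b i j ^ 2), ← mul_assoc]
            gcongr
            rw [inv_mul_le_iff₀ (hθ0 j)]
            exact hbθ i j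
        _ ≤ (u i ^ (-δ)) ^ 2 * D₁ ^ 2 := by
            rw [← Finset.mul_sum]
            have := hD₁ i
            simp only [Real.rpow_two, sq_abs] at this
            gcongr
        _ ≤ (D₁ + τ) ^ 2 * (u i ^ (-δ)) ^ 2 := by
            rw [mul_comm]
            gcongr
            linarith)
    (by simpa only [hpow _ (hu0 _)] using hus)
  have hmp := measurePreserving_comp_inl_stdGaussian (X := ι × κ) (Y := ι ⊕ (κ ⊕ (κ ⊕ κ)))
  have hL' := (hmp.integrable_comp hL.aestronglyMeasurable).2 hL
  have hLint : ∫ g, L g ∂(_root_.stdGaussian (ι × κ)) =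
      ∫ g, L (fun x => g (Sum.inl x)) ∂(_root_.stdGaussian ((ι × κ) ⊕ (ι ⊕ (κ ⊕ (κ ⊕ κ))))) := by
    rw [← hmp.map_eq]
    exact integral_map hmp.measurable.aemeasurable (hmp.map_eq ▸ hL.aestronglyMeasurable)
  have h12 : Integrable (fun g => √2 * Q₁ g + √2 * Q₂ g)
      (_root_.stdGaussian ((ι × κ) ⊕ (ι ⊕ (κ ⊕ (κ ⊕ κ))))) :=
    (hQ₁i.const_mul _).add (hQ₂i.const_mul _)
  have h123 : Integrable (fun g => √2 * Q₁ g + √2 * Q₂ g + Q₃ g)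
      (_root_.stdGaussian ((ι × κ) ⊕ (ι ⊕ (κ ⊕ (κ ⊕ κ))))) := h12.add hQ₃i
  have hUi : Integrable (fun g => √2 * Q₁ g + √2 * Q₂ g + Q₃ g + Q₄ g)
      (_root_.stdGaussian ((ι × κ) ⊕ (ι ⊕ (κ ⊕ (κ ⊕ κ))))) := h123.add hQ₄i
  have hSF := sudakov_fernique horth hinc (L := fun g => L fun x => g (Sum.inl x)) hL' hUi
    (fun g => by
      obtain ⟨a, ha⟩ := hLx fun x => g (Sum.inl x)
      refine ⟨a, ha.trans (le_of_eq ?_)⟩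
      simp [X, Fintype.sum_sum_type, Fintype.sum_prod_type])
    (fun g a => by
      have h1 := sum_mul_sqrt_mul_le hq hr (hs a) (hs1 a) (ht1 a) (hQ₁0 g) (hQ₁ g)
      have h2 := sum_mul_sqrt_mul_le le_rfl (Real.HolderConjugate.two_two) (ht a)
        (by simpa only [Real.rpow_two] using ht1 a) (hs2 a) (hQ₂0 g) (hQ₂ g)
      have h3 : ∑ j, √(θ j) * t a j ^ 2 * g (Sum.inr (Sum.inr (Sum.inr (Sum.inl j)))) ≤ Q₃ g := by
        calc _ = ∑ j, t a j ^ 2 * (√(θ j) * g (Sum.inr (Sum.inr (Sum.inr (Sum.inl j))))) :=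
              Finset.sum_congr rfl fun j _ => by ring
          _ ≤ ∑ j, t a j ^ 2 * Q₃ g := by
              gcongr with j
              have := (le_abs_self _).trans (hQ₃ g j)
              simpa [Pi.single_apply] using this
          _ = (∑ j, t a j ^ 2) * Q₃ g := (Finset.sum_mul _ _ _).symm
          _ ≤ Q₃ g := mul_le_of_le_one_left (hQ₃0 g) (ht1 a)
      have h4 : ∑ j, (√(θ j))⁻¹ * (∑ i, b i j ^ 2 * s a i ^ 2) *
          g (Sum.inr (Sum.inr (Sum.inr (Sum.inr j)))) ≤ Q₄ g := by
        calc _ = ∑ i, s a i ^ 2 * ∑ j, (√(θ j))⁻¹ * b i j ^ 2 *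
                g (Sum.inr (Sum.inr (Sum.inr (Sum.inr j)))) := by
              simp only [Finset.mul_sum, Finset.sum_mul]
              rw [Finset.sum_comm]
              exact Finset.sum_congr rfl fun i _ => Finset.sum_congr rfl fun j _ => by ring
          _ ≤ ∑ i, s a i ^ 2 * Q₄ g := by
              gcongr with i
              have := (le_abs_self _).trans (hQ₄ g i)
              simpa [Fintype.sum_sum_type] using this
          _ = (∑ i, s a i ^ 2) * Q₄ g := (Finset.sum_mul _ _ _).symm
          _ ≤ Q₄ g := mul_le_of_le_one_left (hQ₄0 g) (hs2 a)
      simp only [Y, Fintype.sum_sum_type, Sum.elim_inl, Sum.elim_inr, zero_mul,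
        Finset.sum_const_zero, zero_add, mul_assoc, ← Finset.mul_sum] at h1 h2 h3 h4 ⊢
      have h5 : (0 : ℝ) ≤ √2 := Real.sqrt_nonneg 2
      have h6 := mul_le_mul_of_nonneg_left h1 h5
      have h7 := mul_le_mul_of_nonneg_left h2 h5
      linarith)
  rw [hLint]
  refine hSF.trans ?_
  rw [integral_add h123 hQ₄i, integral_add h12 hQ₃i,
    integral_add (hQ₁i.const_mul _) (hQ₂i.const_mul _), integral_const_mul, integral_const_mul]
  have h2le : √2 ≤ 1.5 := by
    rw [Real.sqrt_le_left (by norm_num)]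
    norm_num
  have hqs : √q ≤ Λ := by
    rw [Real.sqrt_le_left hΛ0.le]
    nlinarith
  have hNs : √(64 * Λ) ≤ 8 * Λ := by
    rw [Real.sqrt_le_left (by positivity)]
    nlinarith
  set I₁ := ∫ g, Q₁ g ∂(_root_.stdGaussian ((ι × κ) ⊕ (ι ⊕ (κ ⊕ (κ ⊕ κ)))))
  set I₂ := ∫ g, Q₂ g ∂(_root_.stdGaussian ((ι × κ) ⊕ (ι ⊕ (κ ⊕ (κ ⊕ κ)))))
  set I₃ := ∫ g, Q₃ g ∂(_root_.stdGaussian ((ι × κ) ⊕ (ι ⊕ (κ ⊕ (κ ⊕ κ)))))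
  set I₄ := ∫ g, Q₄ g ∂(_root_.stdGaussian ((ι × κ) ⊕ (ι ⊕ (κ ⊕ (κ ⊕ κ)))))
  have k1 : √2 * I₁ ≤ 1.5 * (6 * Λ * D₂ + 585 * Λ * τ) := by
    have : I₁ ≤ 6 * Λ * D₂ + 585 * Λ * τ := hQ₁I.trans (by gcongr)
    have h0 : 0 ≤ 6 * Λ * D₂ + 585 * Λ * τ := by positivity
    calc √2 * I₁ ≤ √2 * (6 * Λ * D₂ + 585 * Λ * τ) := by gcongr
      _ ≤ _ := by gcongr
  have k2 : √2 * I₂ ≤ 1.5 * (6 * Λ * D₁ + 585 * Λ * τ) := by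
    have : I₂ ≤ 6 * Λ * D₁ + 585 * Λ * τ := hQ₂I.trans (by gcongr; linarith)
    have h0 : 0 ≤ 6 * Λ * D₁ + 585 * Λ * τ := by positivity
    calc √2 * I₂ ≤ √2 * (6 * Λ * D₁ + 585 * Λ * τ) := by gcongr
      _ ≤ _ := by gcongr
  have k3 : I₃ ≤ 8 * Λ * τ * (1 + 2 * 2) := hQ₃I.trans (by gcongr)
  have k4 : I₄ ≤ 8 * Λ * (D₁ + τ) * (1 + 2 * 2) := hQ₄I.trans (by gcongr)
  have p1 : 0 ≤ Λ * D₁ := by positivity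
  have p2 : 0 ≤ Λ * D₂ := by positivity
  have p3 : 0 ≤ Λ * τ := by positivity
  linarith

theorem measurePreserving_signs_mul_stdGaussian {X : Type*} [Fintype X] (ε : X → ℤˣ) :
    MeasurePreserving (fun (g : X → ℝ) k => ((ε k : ℤ) : ℝ) * g k) (_root_.stdGaussian X)
      (_root_.stdGaussian X) := by
  unfold _root_.stdGaussian
  refine measurePreserving_pi _ _ (f := fun k x => ((ε k : ℤ) : ℝ) * x) fun k => ⟨by fun_prop, ?_⟩
  rw [gaussianReal_map_const_mul]
  congr 1
  · simp
  · ext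
    rcases Int.units_eq_one_or (ε k) with h | h <;> simp [h]

theorem integrable_comp_signs_mul_stdGaussian {X : Type*} [Fintype X] {f : (X → ℝ) → ℝ}
    (hf : Integrable f (_root_.stdGaussian X)) (ε : X → ℤˣ) :
    Integrable (fun g => f fun k => ((ε k : ℤ) : ℝ) * g k) (_root_.stdGaussian X) :=
  ((measurePreserving_signs_mul_stdGaussian ε).integrable_comp hf.aestronglyMeasurable).2 hf

theorem integral_sum_signs_mul_stdGaussian {X : Type*} [Fintype X] [DecidableEq X]
    {f : (X → ℝ) → ℝ} (hf : Integrable f (_root_.stdGaussian X)) :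
    ∫ g, ∑ ε : X → ℤˣ, f (fun k => ((ε k : ℤ) : ℝ) * g k) ∂(_root_.stdGaussian X)
      = Fintype.card (X → ℤˣ) * ∫ g, f g ∂(_root_.stdGaussian X) := by
  rw [integral_finsetSum _ fun ε _ => integrable_comp_signs_mul_stdGaussian hf ε]
  have h : ∀ ε : X → ℤˣ, ∫ g, f (fun k => ((ε k : ℤ) : ℝ) * g k) ∂(_root_.stdGaussian X)
      = ∫ g, f g ∂(_root_.stdGaussian X) := by
    intro ε
    have hmp := measurePreserving_signs_mul_stdGaussian ε
    conv_rhs => rw [← hmp.map_eq]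
    exact (integral_map hmp.measurable.aemeasurable
      (hmp.map_eq.symm ▸ hf.aestronglyMeasurable)).symm
  simp [h]

theorem integral_abs_gaussianReal_pos : 0 < ∫ x, |x| ∂(gaussianReal 0 1) := by
  have hi : Integrable (fun x : ℝ => |x|) (gaussianReal 0 1) :=
    ((memLp_id_gaussianReal 1).integrable le_rfl).abs
  rw [integral_pos_iff_support_of_nonneg (fun x => abs_nonneg x) hi]
  have h : Function.support (fun x : ℝ => |x|) = {0}ᶜ := by
    ext x
    simp
  have := nullSingletonClass_gaussianReal (μ := 0) (v := 1) one_ne_zero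
  rw [h, prob_compl_eq_one_sub (measurableSet_singleton 0), measure_singleton]
  simp

/-- Averages over signs are dominated by Gaussian averages. -/
theorem sum_signs_form_le_integral {X : Type*} [Fintype X] [DecidableEq X] {f : (X → ℝ) → ℝ}
    (hf : Integrable f (_root_.stdGaussian X)) (c : (X → ℤˣ) → X → ℝ)
    (hc : ∀ ε x, ∑ k, c ε k * x k ≤ f x) :
    (∫ x, |x| ∂(gaussianReal 0 1)) * ∑ ε : X → ℤˣ, ∑ k, c ε k * ((ε k : ℤ) : ℝ)
      ≤ Fintype.card (X → ℤˣ) * ∫ g, f g ∂(_root_.stdGaussian X) := by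
  rw [← integral_sum_signs_mul_stdGaussian hf]
  have habs : ∀ k, ∫ g : X → ℝ, |g k| ∂(_root_.stdGaussian X) = ∫ x, |x| ∂(gaussianReal 0 1) := by
    intro k
    have h : MeasurePreserving (Function.eval k) (_root_.stdGaussian X) (gaussianReal 0 1) :=
      measurePreserving_eval _ k
    rw [← h.map_eq]
    exact (integral_map h.measurable.aemeasurable
      (by exact continuous_abs.aestronglyMeasurable)).symm
  have hi : Integrable (fun g : X → ℝ => ∑ ε : X → ℤˣ, ∑ k, c ε k * ((ε k : ℤ) : ℝ) * |g k|)
      (_root_.stdGaussian X) :=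
    integrable_finsetSum _ fun ε _ => integrable_finsetSum _ fun k _ =>
      (integrable_eval_stdGaussian k).abs.const_mul _
  calc _ = ∫ g : X → ℝ, ∑ ε : X → ℤˣ, ∑ k, c ε k * ((ε k : ℤ) : ℝ) * |g k|
        ∂(_root_.stdGaussian X) := by
        rw [integral_finsetSum _ fun ε _ => integrable_finsetSum _ fun k _ =>
          (integrable_eval_stdGaussian k).abs.const_mul _, Finset.mul_sum]
        refine Finset.sum_congr rfl fun ε _ => ?_
        rw [integral_finsetSum _ fun k _ => (integrable_eval_stdGaussian k).abs.const_mul _,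
          Finset.mul_sum]
        refine Finset.sum_congr rfl fun k _ => ?_
        rw [integral_const_mul, habs, mul_comm]
    _ ≤ _ := by
        refine integral_mono hi
          (integrable_finsetSum _ fun ε _ => integrable_comp_signs_mul_stdGaussian hf ε)
          fun g => ?_
        simp only
        let σ : X → ℤˣ := fun k => if 0 ≤ g k then 1 else -1
        have hσ : ∀ k, ((σ k : ℤ) : ℝ) * g k = |g k| := by
          intro k
          by_cases h : 0 ≤ g k
          · simp [σ, h, abs_of_nonneg h]
          · simp [σ, h, abs_of_neg (not_le.1 h)]
        rw [← Equiv.sum_comp (Equiv.mulRight σ)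
          fun ε : X → ℤˣ => f fun k => ((ε k : ℤ) : ℝ) * g k]
        refine Finset.sum_le_sum fun ε _ => ?_
        refine le_trans (le_of_eq ?_) (hc ε _)
        refine Finset.sum_congr rfl fun k _ => ?_
        simp only [Equiv.coe_mulRight, Pi.mul_apply, Units.val_mul, Int.cast_mul]
        rw [mul_assoc ((ε k : ℤ) : ℝ), hσ, mul_assoc]

theorem exists_integrable_max_forms {A X : Type*} [Fintype A] [Nonempty A] [Fintype X]
    (c : A → X → ℝ) : ∃ f : (X → ℝ) → ℝ, Integrable f (_root_.stdGaussian X) ∧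
      (∀ a x, ∑ k, c a k * x k ≤ f x) ∧ ∀ x, ∃ a, f x = ∑ k, c a k * x k := by
  let F : A → (X → ℝ) → ℝ := fun a x => ∑ k, c a k * x k
  refine ⟨fun x => Finset.univ.sup' Finset.univ_nonempty fun a => F a x, ?_,
    fun a x => Finset.le_sup' (fun a => F a x) (Finset.mem_univ a), fun x => ?_⟩
  · refine Integrable.mono' (g := fun x => ∑ a, |F a x|)
      (integrable_finsetSum _ fun a _ => (integrable_form_stdGaussian (c a)).abs) ?_ ?_
    · refine Continuous.aestronglyMeasurable ?_
      exact Continuous.finset_sup'_apply _ fun a _ => by fun_prop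
    · refine Filter.Eventually.of_forall fun x => ?_
      obtain ⟨a, -, ha⟩ := Finset.exists_mem_eq_sup' Finset.univ_nonempty fun a => F a x
      rw [ha, Real.norm_eq_abs]
      exact Finset.single_le_sum (f := fun a => |F a x|) (fun _ _ => abs_nonneg _)
        (Finset.mem_univ a)
  · obtain ⟨a, -, ha⟩ := Finset.exists_mem_eq_sup' Finset.univ_nonempty fun a => F a x
    exact ⟨a, ha⟩

/-- A bound for sign averages of bilinear forms on `ℓ_{q*} × ℓ_2`. -/
theorem sum_signs_bilinear_le {ι κ : Type*} [Fintype ι] [Fintype κ] [DecidableEq ι]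
    [DecidableEq κ] {b : ι → κ → ℝ} {u : ι → ℝ} {v : κ → ℝ}
    (hu : ∀ i, 1 ≤ u i) (hv : ∀ j, 1 ≤ v j) (hus : ∑ i, u i ^ (-2 : ℝ) ≤ 2)
    (hvs : ∑ j, v j ^ (-2 : ℝ) ≤ 2) {q r Λ τ D₁ D₂ : ℝ} (hq : 2 ≤ q) (hqΛ : q ≤ Λ)
    (hr : r.HolderConjugate q) (hτ : 0 < τ) (hD₁0 : 0 ≤ D₁) (hD₂0 : 0 ≤ D₂)
    (hb : ∀ i j, |b i j| ≤ τ * (u i * v j) ^ (-(1 / (32 * Λ))))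
    (hD₁ : ∀ i, ∑ j, |b i j| ^ (2 : ℝ) ≤ D₁ ^ (2 : ℝ)) (hD₂ : ∀ j, ∑ i, |b i j| ^ q ≤ D₂ ^ q)
    {s : (ι × κ → ℤˣ) → ι → ℝ} {t : (ι × κ → ℤˣ) → κ → ℝ} (hs : ∀ a i, 0 ≤ s a i)
    (ht : ∀ a j, 0 ≤ t a j) (hs1 : ∀ a, ∑ i, s a i ^ r ≤ 1)
    (ht1 : ∀ a, ∑ j, t a j ^ (2 : ℝ) ≤ 1) :
    (∫ x, |x| ∂(gaussianReal 0 1)) * ∑ ε : ι × κ → ℤˣ,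
        ∑ i, ∑ j, ((ε (i, j) : ℤ) : ℝ) * b i j * s ε i * t ε j
      ≤ Fintype.card (ι × κ → ℤˣ) * (2000 * Λ * (D₁ + D₂ + τ)) := by
  obtain ⟨f, hfi, hf, hfx⟩ := exists_integrable_max_forms
    fun (a : ι × κ → ℤˣ) (k : ι × κ) => b k.1 k.2 * s a k.1 * t a k.2
  have h1 := sum_signs_form_le_integral hfi _ hf
  have h2 := integral_gaussian_bilinear_le hu hv hus hvs hq hqΛ hr hτ hD₁0 hD₂0 hb hD₁ hD₂ hs ht
    hs1 (fun a => by simpa only [Real.rpow_two] using ht1 a) hfi (fun g => by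
      obtain ⟨a, ha⟩ := hfx g
      exact ⟨a, by rw [ha, Fintype.sum_prod_type]⟩)
  refine le_trans (le_of_eq ?_) (h1.trans (by gcongr))
  congr 1
  refine Finset.sum_congr rfl fun ε _ => ?_
  rw [Fintype.sum_prod_type]
  exact Finset.sum_congr rfl fun i _ => Finset.sum_congr rfl fun j _ => by ring

/-- A bound for sign averages of bilinear forms on `ℓ_{q*} × ℓ_p` when `p* = 2` or `q = 2`. -/
theorem sum_signs_bilinear_le_of_eq_two {ι κ : Type*} [Fintype ι] [Fintype κ] [DecidableEq ι]
    [DecidableEq κ] {b : ι → κ → ℝ} {u : ι → ℝ} {v : κ → ℝ}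
    (hu : ∀ i, 1 ≤ u i) (hv : ∀ j, 1 ≤ v j) (hus : ∑ i, u i ^ (-2 : ℝ) ≤ 2)
    (hvs : ∑ j, v j ^ (-2 : ℝ) ≤ 2) {P Q p r Λ τ D₁ D₂ : ℝ} (hP : 2 ≤ P) (hQ : 2 ≤ Q)
    (hPQ : P = 2 ∨ Q = 2) (hPΛ : P ≤ Λ) (hQΛ : Q ≤ Λ) (hp : p.HolderConjugate P)
    (hr : r.HolderConjugate Q) (hτ : 0 < τ) (hD₁0 : 0 ≤ D₁) (hD₂0 : 0 ≤ D₂)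
    (hb : ∀ i j, |b i j| ≤ τ * (u i * v j) ^ (-(1 / (32 * Λ))))
    (hD₁ : ∀ i, ∑ j, |b i j| ^ P ≤ D₁ ^ P) (hD₂ : ∀ j, ∑ i, |b i j| ^ Q ≤ D₂ ^ Q)
    {s : (ι × κ → ℤˣ) → ι → ℝ} {t : (ι × κ → ℤˣ) → κ → ℝ} (hs : ∀ a i, 0 ≤ s a i)
    (ht : ∀ a j, 0 ≤ t a j) (hs1 : ∀ a, ∑ i, s a i ^ r ≤ 1)
    (ht1 : ∀ a, ∑ j, t a j ^ p ≤ 1) :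
    (∫ x, |x| ∂(gaussianReal 0 1)) * ∑ ε : ι × κ → ℤˣ,
        ∑ i, ∑ j, ((ε (i, j) : ℤ) : ℝ) * b i j * s ε i * t ε j
      ≤ Fintype.card (ι × κ → ℤˣ) * (2000 * Λ * (D₁ + D₂ + τ)) := by
  have h2 : ∀ x : ℝ, x.HolderConjugate 2 → x = 2 := fun x hx => by
    have := hx.sub_one_mul_conj
    linarith
  rcases hPQ with rfl | rfl
  · obtain rfl := h2 p hp
    exact sum_signs_bilinear_le hu hv hus hvs hQ hQΛ hr hτ hD₁0 hD₂0 hb hD₁ hD₂ hs ht hs1 ht1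
  · obtain rfl := h2 r hr
    let E : (κ × ι → ℤˣ) ≃ (ι × κ → ℤˣ) := Equiv.arrowCongr (Equiv.prodComm κ ι) (Equiv.refl _)
    have h := sum_signs_bilinear_le (b := fun j i => b i j) hv hu hvs hus hP hPΛ hp hτ hD₂0 hD₁0
      (fun j i => by rw [mul_comm (v j)]; exact hb i j) hD₂ hD₁ (s := fun ε => t (E ε))
      (t := fun ε => s (E ε)) (fun _ => ht _) (fun _ => hs _) (fun _ => ht1 _) (fun _ => hs1 _)
    rw [Fintype.card_congr E, add_comm D₂] at h
    refine le_trans (le_of_eq ?_) h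
    rw [← Equiv.sum_comp E]
    congr 1
    refine Finset.sum_congr rfl fun ε _ => ?_
    rw [Finset.sum_comm]
    refine Finset.sum_congr rfl fun j _ => Finset.sum_congr rfl fun i _ => ?_
    simp only [E, Equiv.arrowCongr_apply, Function.comp_apply, Equiv.prodComm_symm,
      Equiv.prodComm_apply, Prod.swap_prod_mk, Equiv.refl_apply]
    ring

theorem Complex.eq_sum_I_pow_mul_max (w : ℂ) :
    w = ∑ k : Fin 4, Complex.I ^ (k : ℕ) * (max ((-Complex.I) ^ (k : ℕ) * w).re 0 : ℝ) := by
  have h : ∀ x : ℝ, max x 0 - max (-x) 0 = x := fun x => by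
    rcases le_total x 0 with h | h
    · rw [max_eq_right h, max_eq_left (by linarith)]; ring
    · rw [max_eq_left h, max_eq_right (by linarith)]; ring
  apply Complex.ext
  · simp [Fin.sum_univ_four, pow_succ]
    linarith [h w.re]
  · simp [Fin.sum_univ_four, pow_succ]
    linarith [h w.im]

/-- The complex version of `sum_signs_bilinear_le_of_eq_two`. -/
theorem norm_sum_signs_bilinear_le {ι κ : Type*} [Fintype ι] [Fintype κ] [DecidableEq ι]
    [DecidableEq κ] {b : ι → κ → ℂ} {u : ι → ℝ} {v : κ → ℝ}
    (hu : ∀ i, 1 ≤ u i) (hv : ∀ j, 1 ≤ v j) (hus : ∑ i, u i ^ (-2 : ℝ) ≤ 2)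
    (hvs : ∑ j, v j ^ (-2 : ℝ) ≤ 2) {P Q p r Λ τ D₁ D₂ : ℝ} (hP : 2 ≤ P) (hQ : 2 ≤ Q)
    (hPQ : P = 2 ∨ Q = 2) (hPΛ : P ≤ Λ) (hQΛ : Q ≤ Λ) (hp : p.HolderConjugate P)
    (hr : r.HolderConjugate Q) (hτ : 0 < τ) (hD₁0 : 0 ≤ D₁) (hD₂0 : 0 ≤ D₂)
    (hb : ∀ i j, ‖b i j‖ ≤ τ * (u i * v j) ^ (-(1 / (32 * Λ))))
    (hD₁ : ∀ i, ∑ j, ‖b i j‖ ^ P ≤ D₁ ^ P) (hD₂ : ∀ j, ∑ i, ‖b i j‖ ^ Q ≤ D₂ ^ Q)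
    {s : (ι × κ → ℤˣ) → ι → ℂ} {t : (ι × κ → ℤˣ) → κ → ℂ}
    (hs1 : ∀ a, ∑ i, ‖s a i‖ ^ r ≤ 1) (ht1 : ∀ a, ∑ j, ‖t a j‖ ^ p ≤ 1) :
    (∫ x, |x| ∂(gaussianReal 0 1)) * ‖∑ ε : ι × κ → ℤˣ,
        ∑ i, ∑ j, ((ε (i, j) : ℤ) : ℂ) * b i j * s ε i * t ε j‖
      ≤ Fintype.card (ι × κ → ℤˣ) * (64000 * Λ * (D₁ + D₂ + τ)) := by
  set c₀ := ∫ x, |x| ∂(gaussianReal 0 1) with hc₀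
  have hc : 0 < c₀ := integral_abs_gaussianReal_pos
  set B : ℝ := Fintype.card (ι × κ → ℤˣ) * (2000 * Λ * (D₁ + D₂ + τ)) with hB
  have hP0 : 0 < P := by linarith
  have hQ0 : 0 < Q := by linarith
  let pos : Fin 4 → ℂ → ℝ := fun k w => max ((-Complex.I) ^ (k : ℕ) * w).re 0
  have hpos0 : ∀ k w, 0 ≤ pos k w := fun k w => le_max_right _ _
  have hposle : ∀ k w, pos k w ≤ ‖w‖ := fun k w => by
    refine max_le ((Complex.re_le_norm _).trans (le_of_eq ?_)) (norm_nonneg _)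
    simp
  have hpos : ∀ w, w = ∑ k : Fin 4, Complex.I ^ (k : ℕ) * (pos k w : ℂ) := Complex.eq_sum_I_pow_mul_max
  let X : (ι → κ → ℝ) → Fin 4 → Fin 4 → ℝ := fun b' k l => ∑ ε : ι × κ → ℤˣ,
    ∑ i, ∑ j, ((ε (i, j) : ℤ) : ℝ) * b' i j * pos k (s ε i) * pos l (t ε j)
  have hX : ∀ b' : ι → κ → ℝ, (∀ i j, |b' i j| ≤ ‖b i j‖) → ∀ k l, c₀ * |X b' k l| ≤ B := by
    have key : ∀ b' : ι → κ → ℝ, (∀ i j, |b' i j| ≤ ‖b i j‖) → ∀ k l, c₀ * X b' k l ≤ B := by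
      intro b' hb' k l
      refine sum_signs_bilinear_le_of_eq_two hu hv hus hvs hP hQ hPQ hPΛ hQΛ hp hr hτ hD₁0 hD₂0
        (fun i j => (hb' i j).trans (hb i j)) (fun i => le_trans ?_ (hD₁ i))
        (fun j => le_trans ?_ (hD₂ j)) (fun _ _ => hpos0 _ _) (fun _ _ => hpos0 _ _)
        (fun ε => le_trans ?_ (hs1 ε)) (fun ε => le_trans ?_ (ht1 ε))
      · gcongr with j; exact hb' i j
      · gcongr with i; exact hb' i j
      · have := hr.pos
        gcongr with i
        exact hposle _ _
      · have := hp.pos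
        gcongr with i
        exact hposle _ _
    intro b' hb' k l
    rcases abs_choice (X b' k l) with h | h
    · rw [h]
      exact key b' hb' k l
    · have hneg : -X b' k l = X (fun i j => -b' i j) k l := by
        simp only [X, mul_neg, neg_mul, Finset.sum_neg_distrib]
      rw [h, hneg]
      exact key _ (fun i j => by rw [abs_neg]; exact hb' i j) k l
  have hsum : ∑ ε : ι × κ → ℤˣ, ∑ i, ∑ j, ((ε (i, j) : ℤ) : ℂ) * b i j * s ε i * t ε j
      = ∑ k : Fin 4, ∑ l : Fin 4, Complex.I ^ (k : ℕ) * Complex.I ^ (l : ℕ) *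
        ((X (fun i j => (b i j).re) k l : ℂ) + Complex.I * (X (fun i j => (b i j).im) k l : ℂ)) := by
    have hterm : ∀ (ε : ι × κ → ℤˣ) i j, ((ε (i, j) : ℤ) : ℂ) * b i j * s ε i * t ε j
        = ∑ k : Fin 4, ∑ l : Fin 4, Complex.I ^ (k : ℕ) * Complex.I ^ (l : ℕ) *
          ((((ε (i, j) : ℤ) : ℝ) * (b i j).re * pos k (s ε i) * pos l (t ε j) : ℝ) +
            Complex.I * (((ε (i, j) : ℤ) : ℝ) * (b i j).im * pos k (s ε i) * pos l (t ε j) : ℝ)) := by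
      intro ε i j
      conv_lhs => rw [← Complex.re_add_im (b i j), hpos (s ε i), hpos (t ε j), mul_assoc,
        Finset.sum_mul_sum, Finset.mul_sum]
      refine Finset.sum_congr rfl fun k _ => ?_
      rw [Finset.mul_sum]
      refine Finset.sum_congr rfl fun l _ => ?_
      push_cast
      ring
    simp only [hterm, X, Complex.ofReal_sum]
    simp only [Finset.mul_sum, ← Finset.sum_add_distrib]
    simp only [Fin.sum_univ_four, Finset.sum_add_distrib]
  rw [hsum]
  have hterm : ∀ k l : Fin 4, c₀ * ‖Complex.I ^ (k : ℕ) * Complex.I ^ (l : ℕ) *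
        ((X (fun i j => (b i j).re) k l : ℂ) + Complex.I * (X (fun i j => (b i j).im) k l : ℂ))‖
      ≤ 2 * B := by
    intro k l
    have h1 := hX _ (fun i j => Complex.abs_re_le_norm (b i j)) k l
    have h2 := hX _ (fun i j => Complex.abs_im_le_norm (b i j)) k l
    rw [norm_mul, norm_mul, norm_pow, norm_pow, Complex.norm_I, one_pow, one_pow, one_mul, one_mul]
    refine (mul_le_mul_of_nonneg_left (norm_add_le _ _) hc.le).trans ?_
    rw [norm_mul, Complex.norm_I, one_mul, Complex.norm_real, Complex.norm_real, Real.norm_eq_abs,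
      Real.norm_eq_abs]
    linarith
  calc _ ≤ c₀ * ∑ k : Fin 4, ∑ l : Fin 4, ‖Complex.I ^ (k : ℕ) * Complex.I ^ (l : ℕ) *
        ((X (fun i j => (b i j).re) k l : ℂ) + Complex.I * (X (fun i j => (b i j).im) k l : ℂ))‖ := by
        refine mul_le_mul_of_nonneg_left ?_ hc.le
        exact (norm_sum_le _ _).trans (Finset.sum_le_sum fun k _ => norm_sum_le _ _)
    _ ≤ ∑ k : Fin 4, ∑ l : Fin 4, 2 * B := by
        simp only [Finset.mul_sum]
        exact Finset.sum_le_sum fun k _ => Finset.sum_le_sum fun l _ => hterm k l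
    _ = _ := by
        simp only [Finset.sum_const, Finset.card_univ, Fintype.card_fin, nsmul_eq_mul, hB]
        push_cast
        ring

/-- The signed complex power `sgn(x) |x| ^ w`. -/
noncomputable def signedCPow (x : ℝ) (w : ℂ) : ℂ :=
  if x = 0 then 0 else (SignType.sign x : ℂ) * Complex.exp (w * Real.log |x|)

theorem signedCPow_one (x : ℝ) : signedCPow x 1 = x := by
  unfold signedCPow
  split_ifs with h
  · simp [h]
  · rw [one_mul, ← Complex.ofReal_exp, Real.exp_log (abs_pos.2 h)]
    rcases lt_or_gt_of_ne h with h | h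
    · simp [h, abs_of_neg]
    · simp [h, abs_of_pos]

theorem norm_signedCPow_of_ne_zero {x : ℝ} (hx : x ≠ 0) (w : ℂ) :
    ‖signedCPow x w‖ = |x| ^ w.re := by
  rw [signedCPow, if_neg hx, norm_mul, Complex.norm_exp, Real.rpow_def_of_pos (abs_pos.2 hx),
    Complex.re_mul_ofReal, mul_comm w.re]
  rcases lt_or_gt_of_ne hx with h | h <;> simp [h]

theorem norm_signedCPow {x : ℝ} {w : ℂ} (hw : w.re ≠ 0) : ‖signedCPow x w‖ = |x| ^ w.re := by
  by_cases hx : x = 0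
  · simp [signedCPow, hx, hw]
  · exact norm_signedCPow_of_ne_zero hx w

theorem norm_signedCPow_le (x : ℝ) (w : ℂ) : ‖signedCPow x w‖ ≤ |x| ^ w.re := by
  by_cases hx : x = 0
  · simp [signedCPow, hx, Real.rpow_nonneg]
  · exact (norm_signedCPow_of_ne_zero hx w).le

theorem norm_signedCPow_ofReal_re (x : ℝ) (w : ℂ) :
    ‖signedCPow x w‖ = ‖signedCPow x (w.re : ℂ)‖ := by
  by_cases hx : x = 0
  · simp [signedCPow, hx]
  · rw [norm_signedCPow_of_ne_zero hx, norm_signedCPow_of_ne_zero hx, Complex.ofReal_re]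

theorem differentiable_signedCPow (x : ℝ) : Differentiable ℂ (signedCPow x) := by
  unfold signedCPow
  split_ifs with h
  · fun_prop
  · fun_prop

/-- The interpolated bound for sign averages of bilinear forms on `ℓ_{q*} × ℓ_p`. -/
theorem sum_signs_bilinear_le_interpolated {ι κ : Type*} [Fintype ι] [Fintype κ] [DecidableEq ι]
    [DecidableEq κ] {h : ι → κ → ℝ} {u : ι → ℝ} {v : κ → ℝ}
    (hu : ∀ i, 1 ≤ u i) (hv : ∀ j, 1 ≤ v j) (hus : ∑ i, u i ^ (-2 : ℝ) ≤ 2)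
    (hvs : ∑ j, v j ^ (-2 : ℝ) ≤ 2) {P Q p q' τ D₁ D₂ K : ℝ} (hP : 2 ≤ P) (hQ : 2 ≤ Q)
    (hp : p.HolderConjugate P) (hq' : q'.HolderConjugate Q) (hτ : 0 < τ) (hD₁0 : 0 ≤ D₁)
    (hD₂0 : 0 ≤ D₂) (hK : 1 ≤ K) (hKc : 64000 ≤ K * ∫ x, |x| ∂(gaussianReal 0 1))
    (hb : ∀ i j, |h i j| ≤ τ * (u i * v j) ^ (-(1 / (32 * max P Q))))
    (hD₁ : ∀ i, ∑ j, |h i j| ^ P ≤ D₁ ^ P) (hD₂ : ∀ j, ∑ i, |h i j| ^ Q ≤ D₂ ^ Q)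
    {s : (ι × κ → ℤˣ) → ι → ℝ} {t : (ι × κ → ℤˣ) → κ → ℝ}
    (hs1 : ∀ a, ∑ i, |s a i| ^ q' ≤ 1) (ht1 : ∀ a, ∑ j, |t a j| ^ p ≤ 1) :
    ∑ ε : ι × κ → ℤˣ, ∑ i, ∑ j, ((ε (i, j) : ℤ) : ℝ) * h i j * s ε i * t ε j
      ≤ Fintype.card (ι × κ → ℤˣ) * (3 * K * max P Q * (D₁ + D₂ + τ)) := by
  set M := max P Q with hM
  set N : ℝ := ((Fintype.card (ι × κ → ℤˣ) : ℕ) : ℝ) with hN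
  have hN0 : 0 < N := by
    rw [hN]
    exact_mod_cast Fintype.card_pos
  have hPM : P ≤ M := le_max_left _ _
  have hQM : Q ≤ M := le_max_right _ _
  have hP0 : 0 < P := by linarith
  have hQ0 : 0 < Q := by linarith
  have hM0 : 0 < M := by linarith
  have hp0 : 0 < p := hp.pos
  have hq'0 : 0 < q' := hq'.pos
  set r : ℝ := min P Q / 2 with hr
  have hr1 : 1 ≤ r := by
    rw [hr, le_div_iff₀ two_pos, one_mul]
    exact le_min hP hQ
  have hr0 : 0 < r := by linarith
  have hrP : 2 * r ≤ P := by
    rw [hr]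
    linarith [min_le_left P Q]
  have hrQ : 2 * r ≤ Q := by
    rw [hr]
    linarith [min_le_right P Q]
  have hP₀ : 2 ≤ P / r := by rwa [le_div_iff₀ hr0]
  have hQ₀ : 2 ≤ Q / r := by rwa [le_div_iff₀ hr0]
  have hor : P / r = 2 ∨ Q / r = 2 := by
    rcases le_total P Q with hle | hle
    · left
      rw [div_eq_iff hr0.ne', hr, min_eq_left hle]
      ring
    · right
      rw [div_eq_iff hr0.ne', hr, min_eq_right hle]
      ring
  have hp₀ := (Real.HolderConjugate.conjExponent (show 1 < P / r by linarith)).symm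
  have hq₀ := (Real.HolderConjugate.conjExponent (show 1 < Q / r by linarith)).symm
  set p₀ := Real.conjExponent (P / r)
  set q₀ := Real.conjExponent (Q / r)
  have hp₀e : (1 - r / P) * p₀ = 1 := by
    have h1 := hp₀.inv_add_inv_eq_one
    have h2 := hp₀.pos
    rw [inv_div] at h1
    rw [show 1 - r / P = p₀⁻¹ by linarith, inv_mul_cancel₀ h2.ne']
  have hq₀e : (1 - r / Q) * q₀ = 1 := by
    have h1 := hq₀.inv_add_inv_eq_one
    have h2 := hq₀.pos
    rw [inv_div] at h1
    rw [show 1 - r / Q = q₀⁻¹ by linarith, inv_mul_cancel₀ h2.ne']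
  have hpe : p * (1 - P⁻¹) = 1 := by
    rw [show 1 - P⁻¹ = p⁻¹ by linarith [hp.inv_add_inv_eq_one], mul_inv_cancel₀ hp0.ne']
  have hqe : q' * (1 - Q⁻¹) = 1 := by
    rw [show 1 - Q⁻¹ = q'⁻¹ by linarith [hq'.inv_add_inv_eq_one], mul_inv_cancel₀ hq'0.ne']
  have hrP1 : 0 < 1 - r / P := by
    have : r / P < 1 := by rw [div_lt_one hP0]; linarith
    linarith
  have hrQ1 : 0 < 1 - r / Q := by
    have : r / Q < 1 := by rw [div_lt_one hQ0]; linarith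
    linarith
  let α : ℂ → ℂ := fun z => (q' : ℂ) * (1 - z * ((r / Q : ℝ) : ℂ))
  let β : ℂ → ℂ := fun z => (p : ℂ) * (1 - z * ((r / P : ℝ) : ℂ))
  have hα : ∀ z, (α z).re = q' * (1 - z.re * (r / Q)) := fun z => by
    simp only [α, Complex.re_ofReal_mul, Complex.sub_re, Complex.one_re, Complex.re_mul_ofReal]
  have hβ : ∀ z, (β z).re = p * (1 - z.re * (r / P)) := fun z => by
    simp only [β, Complex.re_ofReal_mul, Complex.sub_re, Complex.one_re, Complex.re_mul_ofReal]
  let Φ : ℂ → ℂ := fun z => ∑ ε : ι × κ → ℤˣ, ∑ i, ∑ j, ((ε (i, j) : ℤ) : ℂ) *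
    signedCPow (h i j) (r * z) * signedCPow (s ε i) (α z) * signedCPow (t ε j) (β z)
  have hE := differentiable_signedCPow
  have hd : Differentiable ℂ Φ := by
    refine Differentiable.fun_sum fun ε _ => Differentiable.fun_sum fun i _ =>
      Differentiable.fun_sum fun j _ => ?_
    refine ((Differentiable.const_mul ((hE _).comp ?_) _).mul ((hE _).comp ?_)).mul
      ((hE _).comp ?_) <;> fun_prop
  let G : ℝ → ℝ := fun x => ∑ ε : ι × κ → ℤˣ, ∑ i, ∑ j,
    ‖signedCPow (h i j) (r * x)‖ * ‖signedCPow (s ε i) (α x)‖ * ‖signedCPow (t ε j) (β x)‖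
  have hε : ∀ e : ℤˣ, ‖((e : ℤ) : ℂ)‖ = 1 := fun e => by
    rcases Int.units_eq_one_or e with h | h <;> simp [h]
  have hnorm : ∀ z, ‖Φ z‖ ≤ ∑ ε : ι × κ → ℤˣ, ∑ i, ∑ j,
      ‖signedCPow (h i j) (r * z)‖ * ‖signedCPow (s ε i) (α z)‖ * ‖signedCPow (t ε j) (β z)‖ := by
    intro z
    refine (norm_sum_le _ _).trans (Finset.sum_le_sum fun ε _ => (norm_sum_le _ _).trans
      (Finset.sum_le_sum fun i _ => (norm_sum_le _ _).trans (Finset.sum_le_sum fun j _ => ?_)))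
    rw [norm_mul, norm_mul, norm_mul, hε, one_mul]
  have hG : ∀ z, ‖Φ z‖ ≤ G z.re := by
    intro z
    refine (hnorm z).trans (le_of_eq ?_)
    refine Finset.sum_congr rfl fun ε _ => Finset.sum_congr rfl fun i _ =>
      Finset.sum_congr rfl fun j _ => ?_
    rw [norm_signedCPow_ofReal_re _ (r * z), norm_signedCPow_ofReal_re _ (α z),
      norm_signedCPow_ofReal_re _ (β z), norm_signedCPow_ofReal_re _ (r * (z.re : ℂ)),
      norm_signedCPow_ofReal_re _ (α z.re), norm_signedCPow_ofReal_re _ (β z.re)]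
    simp only [hα, hβ, Complex.re_ofReal_mul, Complex.ofReal_re]
  have hGc : Continuous G := by
    have hEc : ∀ x, Continuous (signedCPow x) := fun x => (hE x).continuous
    refine continuous_finsetSum _ fun ε _ => continuous_finsetSum _ fun i _ =>
      continuous_finsetSum _ fun j _ => ?_
    refine (((hEc _).comp ?_).norm.mul ((hEc _).comp ?_).norm).mul ((hEc _).comp ?_).norm <;>
      fun_prop
  have hB : BddAbove ((norm ∘ Φ) '' Complex.HadamardThreeLines.verticalClosedStrip 0 1) := by
    obtain ⟨C, hC⟩ := isCompact_Icc.bddAbove_image (hGc.continuousOn (s := Set.Icc 0 1))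
    refine ⟨C, ?_⟩
    rintro _ ⟨z, hz, rfl⟩
    exact (hG z).trans (hC ⟨z.re, hz, rfl⟩)
  have hleft : ∀ z ∈ Complex.re ⁻¹' {0}, ‖Φ z‖ ≤ N := by
    intro z hz
    have hz0 : z.re = 0 := hz
    refine (hnorm z).trans ?_
    calc _ ≤ ∑ ε : ι × κ → ℤˣ, (1 : ℝ) := by
          refine Finset.sum_le_sum fun ε _ => ?_
          calc _ ≤ ∑ i, ∑ j, |s ε i| ^ q' * |t ε j| ^ p := by
                refine Finset.sum_le_sum fun i _ => Finset.sum_le_sum fun j _ => ?_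
                have h1 := norm_signedCPow_le (h i j) (r * z)
                have h2 := norm_signedCPow_le (s ε i) (α z)
                have h3 := norm_signedCPow_le (t ε j) (β z)
                rw [Complex.re_ofReal_mul, hz0, mul_zero, Real.rpow_zero] at h1
                rw [hα, hz0, zero_mul, sub_zero, mul_one] at h2
                rw [hβ, hz0, zero_mul, sub_zero, mul_one] at h3
                calc _ ≤ 1 * |s ε i| ^ q' * |t ε j| ^ p := by gcongr
                  _ = _ := by rw [one_mul]
            _ = (∑ i, |s ε i| ^ q') * ∑ j, |t ε j| ^ p := (Finset.sum_mul_sum _ _ _ _).symm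
            _ ≤ 1 := mul_le_one₀ (hs1 ε) (by positivity) (ht1 ε)
      _ = N := by simp [hN]
  have hright : ∀ z ∈ Complex.re ⁻¹' {1}, ‖Φ z‖ ≤ N * (K * (M / r) * (D₁ ^ r + D₂ ^ r + τ ^ r)) := by
    intro z hz
    have hz1 : z.re = 1 := hz
    have e1 : ∀ i j, ‖signedCPow (h i j) (r * z)‖ = |h i j| ^ r := fun i j => by
      have : (r * z : ℂ).re = r := by rw [Complex.re_ofReal_mul, hz1, mul_one]
      rw [norm_signedCPow (by rw [this]; exact hr0.ne'), this]
    have e2 : ∀ ε i, ‖signedCPow (s ε i) (α z)‖ ^ q₀ = |s ε i| ^ q' := fun ε i => by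
      have : (α z).re = q' * (1 - r / Q) := by rw [hα, hz1, one_mul]
      rw [norm_signedCPow (by rw [this]; positivity), this, ← Real.rpow_mul (abs_nonneg _),
        mul_assoc, hq₀e, mul_one]
    have e3 : ∀ ε j, ‖signedCPow (t ε j) (β z)‖ ^ p₀ = |t ε j| ^ p := fun ε i => by
      have : (β z).re = p * (1 - r / P) := by rw [hβ, hz1, one_mul]
      rw [norm_signedCPow (by rw [this]; positivity), this, ← Real.rpow_mul (abs_nonneg _),
        mul_assoc, hp₀e, mul_one]
    have hmain := norm_sum_signs_bilinear_le (b := fun i j => signedCPow (h i j) (r * z))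
      hu hv hus hvs hP₀ hQ₀ hor (Λ := M / r) (τ := τ ^ r) (D₁ := D₁ ^ r) (D₂ := D₂ ^ r)
      (by gcongr) (by gcongr) hp₀ hq₀
      (by positivity) (by positivity) (by positivity)
      (fun i j => by
        have hu0 : 0 < u i := by linarith [hu i]
        have hv0 : 0 < v j := by linarith [hv j]
        rw [e1]
        calc |h i j| ^ r ≤ (τ * (u i * v j) ^ (-(1 / (32 * M)))) ^ r :=
              Real.rpow_le_rpow (abs_nonneg _) (hb i j) hr0.le
          _ = _ := by
              rw [Real.mul_rpow hτ.le (by positivity), ← Real.rpow_mul (by positivity)]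
              congr 2
              field_simp)
      (fun i => by
        simp only [e1, ← Real.rpow_mul (abs_nonneg _), ← Real.rpow_mul hD₁0,
          mul_div_cancel₀ _ hr0.ne']
        exact hD₁ i)
      (fun j => by
        simp only [e1, ← Real.rpow_mul (abs_nonneg _), ← Real.rpow_mul hD₂0,
          mul_div_cancel₀ _ hr0.ne']
        exact hD₂ j)
      (s := fun ε i => signedCPow (s ε i) (α z)) (t := fun ε j => signedCPow (t ε j) (β z))
      (fun ε => by simpa only [e2] using hs1 ε) (fun ε => by simpa only [e3] using ht1 ε)
    have hc : 0 < ∫ x, |x| ∂(gaussianReal 0 1) := integral_abs_gaussianReal_pos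
    set c₀ := ∫ x, |x| ∂(gaussianReal 0 1)
    have hS : 0 ≤ D₁ ^ r + D₂ ^ r + τ ^ r := by positivity
    refine le_of_mul_le_mul_left (hmain.trans ?_) hc
    calc N * (64000 * (M / r) * (D₁ ^ r + D₂ ^ r + τ ^ r))
        ≤ N * ((K * c₀) * (M / r) * (D₁ ^ r + D₂ ^ r + τ ^ r)) := by gcongr
      _ = _ := by ring
  have hri : r⁻¹ ≤ 1 := inv_le_one_of_one_le₀ hr1
  have hfin := Complex.HadamardThreeLines.norm_le_interp_of_mem_verticalClosedStrip₀₁' Φ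
    (z := ((r⁻¹ : ℝ) : ℂ)) ⟨by rw [Complex.ofReal_re]; positivity, by rwa [Complex.ofReal_re]⟩
    hd.diffContOnCl hB hleft hright
  rw [Complex.ofReal_re] at hfin
  have hΦ : Φ ((r⁻¹ : ℝ) : ℂ) = ((∑ ε : ι × κ → ℤˣ, ∑ i, ∑ j,
      ((ε (i, j) : ℤ) : ℝ) * h i j * s ε i * t ε j : ℝ) : ℂ) := by
    have a1 : (r : ℂ) * ((r⁻¹ : ℝ) : ℂ) = 1 := by
      rw [← Complex.ofReal_mul, mul_inv_cancel₀ hr0.ne', Complex.ofReal_one]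
    have a2 : α ((r⁻¹ : ℝ) : ℂ) = 1 := by
      simp only [α]
      rw [← Complex.ofReal_mul, ← Complex.ofReal_one, ← Complex.ofReal_sub, ← Complex.ofReal_mul,
        ← hqe]
      congr 3
      field_simp
    have a3 : β ((r⁻¹ : ℝ) : ℂ) = 1 := by
      simp only [β]
      rw [← Complex.ofReal_mul, ← Complex.ofReal_one, ← Complex.ofReal_sub, ← Complex.ofReal_mul,
        ← hpe]
      congr 3
      field_simp
    simp only [Φ, a1, a2, a3, signedCPow_one]
    push_cast
    rfl
  rw [hΦ, Complex.norm_real] at hfin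
  refine (le_abs_self _).trans (hfin.trans ?_)
  have hS : 0 < D₁ + D₂ + τ := by positivity
  have hΛ : 1 ≤ M / r := by
    rw [one_le_div hr0]
    linarith
  have hsum : D₁ ^ r + D₂ ^ r + τ ^ r ≤ 3 * (D₁ + D₂ + τ) ^ r := by
    have b1 : D₁ ^ r ≤ (D₁ + D₂ + τ) ^ r := by gcongr; linarith
    have b2 : D₂ ^ r ≤ (D₁ + D₂ + τ) ^ r := by gcongr; linarith
    have b3 : τ ^ r ≤ (D₁ + D₂ + τ) ^ r := by gcongr; linarith
    linarith
  have hX : 1 ≤ 3 * K * (M / r) := by nlinarith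
  calc N ^ (1 - r⁻¹) * (N * (K * (M / r) * (D₁ ^ r + D₂ ^ r + τ ^ r))) ^ r⁻¹
      ≤ N ^ (1 - r⁻¹) * (N * (K * (M / r) * (3 * (D₁ + D₂ + τ) ^ r))) ^ r⁻¹ := by gcongr
    _ = N ^ (1 - r⁻¹) * (N * ((3 * K * (M / r)) * (D₁ + D₂ + τ) ^ r)) ^ r⁻¹ := by ring_nf
    _ = N * ((3 * K * (M / r)) ^ r⁻¹ * (D₁ + D₂ + τ)) := by
        rw [Real.mul_rpow hN0.le (by positivity), Real.mul_rpow (by positivity) (by positivity),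
          Real.rpow_rpow_inv hS.le hr0.ne', ← mul_assoc, ← Real.rpow_add hN0, sub_add_cancel,
          Real.rpow_one]
    _ ≤ N * ((3 * K * (M / r)) * (D₁ + D₂ + τ)) := by
        gcongr
        exact Real.rpow_le_self_of_one_le hX hri
    _ ≤ N * (3 * K * M * (D₁ + D₂ + τ)) := by
        gcongr
        exact div_le_self hM0.le hr1

theorem sum_rpow_le_rpow_of_lpNorm_le {ι : Type*} [Fintype ι] {r : ℝ≥0∞} (hr : r ≠ ⊤)
    (hr0 : 0 < r.toReal) {x : ι → ℝ} {D : ℝ} (h : _root_.lpNorm r x ≤ D) :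
    ∑ i, |x i| ^ r.toReal ≤ D ^ r.toReal := by
  rw [_root_.lpNorm, if_neg hr] at h
  have h0 : 0 ≤ ∑ i, |x i| ^ r.toReal := by positivity
  calc ∑ i, |x i| ^ r.toReal = ((∑ i, |x i| ^ r.toReal) ^ (1 / r.toReal)) ^ r.toReal := by
        rw [← Real.rpow_mul h0, one_div_mul_cancel hr0.ne', Real.rpow_one]
    _ ≤ D ^ r.toReal := by gcongr

theorem ENNReal.toReal_holderConjugate_of_one_div_add {p P : ℝ≥0∞} (h : 1 / p + 1 / P = 1)
    (hP : 2 ≤ P) (hPt : P ≠ ⊤) : p ≠ ⊤ ∧ p.toReal.HolderConjugate P.toReal ∧ 2 ≤ P.toReal := by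
  have hP2 : 2 ≤ P.toReal := by
    have := ENNReal.toReal_mono hPt hP
    simpa using this
  have hp0 : p ≠ 0 := by
    rintro rfl
    simp at h
  have hP0 : P ≠ 0 := by
    rintro rfl
    simp at h
  have h' := congrArg ENNReal.toReal h
  rw [ENNReal.toReal_add (by simp [hp0]) (by simp [hP0])] at h'
  simp only [one_div, ENNReal.toReal_inv, ENNReal.toReal_one] at h'
  refine ⟨?_, (Real.holderConjugate_iff.2 ⟨by linarith, by linarith⟩).symm, hP2⟩
  rintro rfl
  rw [ENNReal.toReal_top, _root_.inv_zero, zero_add, _root_.inv_eq_one] at h'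
  linarith

theorem sum_fin_add_one_rpow_neg_two_le (m : ℕ) :
    ∑ i : Fin m, ((i : ℝ) + 1) ^ (-2 : ℝ) ≤ 2 := by
  have h := sum_Ioo_inv_sq_le (α := ℝ) 0 (m + 1)
  rw [Nat.cast_zero, zero_add, div_one] at h
  refine le_trans (le_of_eq ?_) h
  rw [Fin.sum_univ_eq_sum_range (fun i => ((i : ℝ) + 1) ^ (-2 : ℝ)),
    show Finset.Ioo 0 (m + 1) = Finset.Ico 1 (m + 1) from rfl, Finset.sum_Ico_eq_sum_range]
  refine Finset.sum_congr (by simp) fun i _ => ?_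
  rw [Real.rpow_neg (by positivity), Real.rpow_two]
  push_cast
  rw [add_comm (1 : ℝ)]

theorem sum_signs_opNorm_le {ι κ : Type*} [Fintype ι] [Fintype κ] [DecidableEq ι]
    [DecidableEq κ] {h : ι → κ → ℝ} {u : ι → ℝ} {v : κ → ℝ}
    (hu : ∀ i, 1 ≤ u i) (hv : ∀ j, 1 ≤ v j) (hus : ∑ i, u i ^ (-2 : ℝ) ≤ 2)
    (hvs : ∑ j, v j ^ (-2 : ℝ) ≤ 2) {p qstar : ℝ≥0∞} (hpt : p ≠ ⊤) (hqt : qstar ≠ ⊤)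
    {P Q τ D₁ D₂ K : ℝ} (hP : 2 ≤ P) (hQ : 2 ≤ Q)
    (hp : p.toReal.HolderConjugate P) (hq : qstar.toReal.HolderConjugate Q) (hτ : 0 < τ)
    (hD₁0 : 0 ≤ D₁) (hD₂0 : 0 ≤ D₂) (hK : 1 ≤ K)
    (hKc : 64000 ≤ K * ∫ x, |x| ∂(gaussianReal 0 1))
    (hb : ∀ i j, |h i j| ≤ τ * (u i * v j) ^ (-(1 / (32 * max P Q))))
    (hD₁ : ∀ i, ∑ j, |h i j| ^ P ≤ D₁ ^ P) (hD₂ : ∀ j, ∑ i, |h i j| ^ Q ≤ D₂ ^ Q) :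
    ∑ ε : ι × κ → ℤˣ, opNorm p qstar (fun i j => ((ε (i, j) : ℤ) : ℝ) * h i j)
      ≤ Fintype.card (ι × κ → ℤˣ) * (3 * K * max P Q * (D₁ + D₂ + τ)) := by
  set N : ℝ := ((Fintype.card (ι × κ → ℤˣ) : ℕ) : ℝ) with hN
  have hN0 : 0 < N := by
    rw [hN]
    exact_mod_cast Fintype.card_pos
  refine le_of_forall_pos_le_add fun η hη => ?_
  have hex : ∀ ε : ι × κ → ℤˣ, ∃ s : ι → ℝ, ∃ t : κ → ℝ, _root_.lpNorm qstar s ≤ 1 ∧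
      _root_.lpNorm p t ≤ 1 ∧ opNorm p qstar (fun i j => ((ε (i, j) : ℤ) : ℝ) * h i j) - η / N
        < ∑ i, ∑ j, ((ε (i, j) : ℤ) : ℝ) * h i j * s i * t j := by
    intro ε
    have hne : { x : ℝ | ∃ s : ι → ℝ, ∃ t : κ → ℝ, _root_.lpNorm qstar s ≤ 1 ∧
        _root_.lpNorm p t ≤ 1 ∧
        x = ∑ i, ∑ j, ((ε (i, j) : ℤ) : ℝ) * h i j * s i * t j }.Nonempty := by
      refine ⟨_, fun _ => 0, fun _ => 0, ?_, ?_, rfl⟩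
      · simp [_root_.lpNorm, hqt, hq.pos.ne', Real.zero_rpow]
      · simp [_root_.lpNorm, hpt, hp.pos.ne', Real.zero_rpow]
    obtain ⟨_, ⟨s, t, hs, ht, rfl⟩, hlt⟩ := exists_lt_of_lt_csSup hne
      (show opNorm p qstar (fun i j => ((ε (i, j) : ℤ) : ℝ) * h i j) - η / N
        < opNorm p qstar (fun i j => ((ε (i, j) : ℤ) : ℝ) * h i j) by
          have : 0 < η / N := by positivity
          linarith)
    exact ⟨s, t, hs, ht, hlt⟩
  choose s t hs ht hlt using hex
  have hmain := sum_signs_bilinear_le_interpolated hu hv hus hvs hP hQ hp hq hτ hD₁0 hD₂0 hK hKc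
    hb hD₁ hD₂ (s := s) (t := t)
    (fun ε => by simpa using sum_rpow_le_rpow_of_lpNorm_le hqt hq.pos (hs ε))
    (fun ε => by simpa using sum_rpow_le_rpow_of_lpNorm_le hpt hp.pos (ht ε))
  calc _ ≤ ∑ ε : ι × κ → ℤˣ,
        ((∑ i, ∑ j, ((ε (i, j) : ℤ) : ℝ) * h i j * s ε i * t ε j) + η / N) :=
        Finset.sum_le_sum fun ε _ => by linarith [hlt ε]
    _ = (∑ ε : ι × κ → ℤˣ, ∑ i, ∑ j, ((ε (i, j) : ℤ) : ℝ) * h i j * s ε i * t ε j) + η := by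
        rw [Finset.sum_add_distrib, Finset.sum_const, Finset.card_univ, nsmul_eq_mul, ← hN,
          mul_div_cancel₀ _ hN0.ne']
    _ ≤ _ := by gcongr

/-- The main estimate, with a multiplicative constant `max P Q` in front of both terms. -/
theorem integral_opNorm_le {ι κ : Type*} [Fintype ι] [Fintype κ] [DecidableEq ι]
    [DecidableEq κ] {a : ι → κ → ℝ} {u : ι → ℝ} {v : κ → ℝ}
    (hu : ∀ i, 1 ≤ u i) (hv : ∀ j, 1 ≤ v j) (hus : ∑ i, u i ^ (-2 : ℝ) ≤ 2)
    (hvs : ∑ j, v j ^ (-2 : ℝ) ≤ 2) {p qstar : ℝ≥0∞} (hpt : p ≠ ⊤) (hqt : qstar ≠ ⊤)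
    {P Q T D₁ D₂ K : ℝ} (hP : 2 ≤ P) (hQ : 2 ≤ Q)
    (hp : p.toReal.HolderConjugate P) (hq : qstar.toReal.HolderConjugate Q) (hT : 0 < T)
    (hD₁0 : 0 ≤ D₁) (hD₂0 : 0 ≤ D₂) (hK : 1 ≤ K)
    (hKc : 64000 ≤ K * ∫ x, |x| ∂(gaussianReal 0 1))
    (hb : ∀ i j, (u i * v j) ^ (1 / (16 * max P Q)) * |a i j| ≤ T)
    (hD₁ : ∀ i, ∑ j, |a i j| ^ P ≤ D₁ ^ P) (hD₂ : ∀ j, ∑ i, |a i j| ^ Q ≤ D₂ ^ Q) :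
    ∫ g, opNorm p qstar (fun i j => a i j * g (i, j)) ∂(_root_.stdGaussian (ι × κ))
      ≤ 3 * K * max P Q * (6 * (√P * D₁ + √Q * D₂) + 1243 * max P Q * T) := by
  set M := max P Q with hM
  have hPM : P ≤ M := le_max_left _ _
  have hQM : Q ≤ M := le_max_right _ _
  have hM0 : 0 < M := by linarith
  by_cases hint : Integrable (fun g : ι × κ → ℝ => opNorm p qstar fun i j => a i j * g (i, j))
      (_root_.stdGaussian (ι × κ))
  swap
  · rw [integral_undef hint]
    positivity
  have hw1 : ∀ i j, 1 ≤ u i * v j := fun i j => one_le_mul_of_one_le_of_one_le (hu i) (hv j)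
  have hw0 : ∀ i j, 0 < u i * v j := fun i j => by linarith [hw1 i j]
  have hadd : -(1 / (16 * M)) = -(1 / (32 * M)) + -(1 / (32 * M)) := by
    field_simp
    norm_num
  have hbT : ∀ i j, |a i j| ≤ T * (u i * v j) ^ (-(1 / (16 * M))) := fun i j => by
    rw [Real.rpow_neg (hw0 i j).le, ← div_eq_mul_inv,
      le_div_iff₀ (Real.rpow_pos_of_pos (hw0 i j) _), mul_comm]
    exact hb i j
  have hbT' : ∀ i j, |a i j| ≤ T * (u i * v j) ^ (-(1 / (32 * M))) := fun i j => by
    refine (hbT i j).trans ?_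
    have : 0 < 1 / (32 * M) := by positivity
    gcongr
    · exact hw1 i j
    · linarith
  obtain ⟨Q₁, hQ₁i, hQ₁0, hQ₁, hQ₁I⟩ := exists_majorant_column_norms (K := ι × κ)
    (b := fun j i => a i j) (e := fun i j => (i, j)) (fun i => Prod.mk_right_injective i)
    hv hu hvs hus hP hPM hT hD₁0 (fun j i => by rw [mul_comm (v j)]; exact hbT' i j) hD₁
  obtain ⟨Q₂, hQ₂i, hQ₂0, hQ₂, hQ₂I⟩ := exists_majorant_column_norms (K := ι × κ)
    (e := fun j i => (i, j)) (fun j => Prod.mk_left_injective j)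
    hu hv hus hvs hQ hQM hT hD₂0 hbT' hD₂
  obtain ⟨Q₃, hQ₃i, hQ₃0, hQ₃, hQ₃I⟩ := exists_majorant_gaussian_forms (K := ι × κ) (S := 4)
    (fun k : ι × κ => Pi.single k (a k.1 k.2 * (u k.1 * v k.2) ^ (1 / (32 * M))))
    (fun k => (u k.1 * v k.2) ^ (-(1 / (32 * M)))) hT (show (1 : ℝ) ≤ 64 * M by linarith)
    (fun k => Real.rpow_pos_of_pos (hw0 _ _) _)
    (fun k => by
      have h0 := hw0 k.1 k.2
      rw [Finset.sum_eq_single k (fun k' _ hk' => by simp [Pi.single_eq_of_ne hk']) (by simp),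
        Pi.single_eq_same, ← sq_abs, abs_mul, abs_of_pos (Real.rpow_pos_of_pos h0 _)]
      refine pow_le_pow_left₀ (by positivity) ?_ 2
      calc |a k.1 k.2| * (u k.1 * v k.2) ^ (1 / (32 * M))
          ≤ T * (u k.1 * v k.2) ^ (-(1 / (16 * M))) * (u k.1 * v k.2) ^ (1 / (32 * M)) := by
            gcongr
            exact hbT _ _
        _ = _ := by
            rw [mul_assoc, ← Real.rpow_add h0, hadd, neg_add_cancel_right])
    (by
      rw [Fintype.sum_prod_type]
      refine le_trans (le_of_eq ?_) (sum_sum_mul_rpow_le hu hv hus hvs le_rfl)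
      refine Finset.sum_congr rfl fun i _ => Finset.sum_congr rfl fun j _ => ?_
      rw [← Real.rpow_mul (hw0 i j).le]
      congr 1
      field_simp
      norm_num)
  have hpt : ∀ g : ι × κ → ℝ, ∑ ε : ι × κ → ℤˣ,
      opNorm p qstar (fun i j => a i j * (((ε (i, j) : ℤ) : ℝ) * g (i, j)))
      ≤ Fintype.card (ι × κ → ℤˣ) * (3 * K * M * (Q₁ g + Q₂ g + (Q₃ g + T))) := by
    intro g
    have hrt : ∀ {x y z : ℝ}, 0 < y → 0 ≤ x → x ^ (1 / y) ≤ z → x ≤ z ^ y := by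
      intro x y z hy hx hxz
      calc x = (x ^ (1 / y)) ^ y := by
            rw [← Real.rpow_mul hx, one_div_mul_cancel hy.ne', Real.rpow_one]
        _ ≤ z ^ y := by gcongr
    have h := sum_signs_opNorm_le (h := fun i j => a i j * g (i, j)) hu hv hus hvs hpt hqt hP hQ
      hp hq (τ := Q₃ g + T) (D₁ := Q₁ g) (D₂ := Q₂ g) (by linarith [hQ₃0 g]) (hQ₁0 g) (hQ₂0 g)
      hK hKc
      (fun i j => by
        have h1 := hQ₃ g (i, j)
        have h0 := hw0 i j
        rw [Finset.sum_eq_single (i, j) (fun k' _ hk' => by simp [Pi.single_eq_of_ne hk'])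
          (by simp), Pi.single_eq_same] at h1
        simp only at h1
        rw [Real.rpow_neg h0.le, ← div_eq_mul_inv, le_div_iff₀ (Real.rpow_pos_of_pos h0 _)]
        calc |a i j * g (i, j)| * (u i * v j) ^ (1 / (32 * M))
            = |a i j * (u i * v j) ^ (1 / (32 * M)) * g (i, j)| := by
              rw [abs_mul, abs_mul, abs_mul, abs_of_pos (Real.rpow_pos_of_pos h0 _)]
              ring
          _ ≤ Q₃ g + T := by linarith)
      (fun i => hrt (by linarith) (by positivity) (hQ₁ g i))
      (fun j => hrt (by linarith) (by positivity) (hQ₂ g j))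
    refine le_trans (le_of_eq ?_) h
    refine Finset.sum_congr rfl fun ε _ => ?_
    congr 1
    funext i j
    ring
  have hN0 : (0 : ℝ) < Fintype.card (ι × κ → ℤˣ) := by exact_mod_cast Fintype.card_pos
  have h3 : Integrable (fun g => Q₃ g + T) (_root_.stdGaussian (ι × κ)) :=
    hQ₃i.add (integrable_const T)
  have h12 : Integrable (fun g => Q₁ g + Q₂ g) (_root_.stdGaussian (ι × κ)) := hQ₁i.add hQ₂i
  have h123 : Integrable (fun g => Q₁ g + Q₂ g + (Q₃ g + T)) (_root_.stdGaussian (ι × κ)) :=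
    h12.add h3
  have hmono := integral_mono (integrable_finsetSum _ fun ε _ =>
    integrable_comp_signs_mul_stdGaussian hint ε) ((h123.const_mul (3 * K * M)).const_mul
      ((Fintype.card (ι × κ → ℤˣ) : ℕ) : ℝ)) hpt
  rw [integral_sum_signs_mul_stdGaussian hint, integral_const_mul, integral_const_mul,
    integral_add h12 h3, integral_add hQ₁i hQ₂i, integral_add hQ₃i (integrable_const T),
    integral_const, probReal_univ, one_smul] at hmono
  refine (le_of_mul_le_mul_left hmono hN0).trans ?_
  have hNs : √(64 * M) ≤ 8 * M := by
    rw [Real.sqrt_le_left (by positivity)]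
    nlinarith
  have h4 : √(64 * M) * T * (1 + 2 * 4) ≤ 8 * M * T * (1 + 2 * 4) := by gcongr
  have h5 : T ≤ M * T := by nlinarith
  refine mul_le_mul_of_nonneg_left ?_ (by positivity)
  linarith

/-- Proposition: bound with the weight `(i+j)^{1/(8(p*∨q))}`:
`E‖G_A‖_{p→q} ≤ C β(p,q)(√(p*) D1 + √q D2) + C (p*∨q) β(p,q) max_{i,j}(i+j)^{1/(8(p*∨q))}|a_{ij}|`,
where `β(p,q) = (p*∨q)^{3/2}` if `1/p + 1/q* ≥ 3/2` and `(p*∨q)^{11/2}` otherwise.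
Rows and columns are indexed starting from `1`, so for `i : Fin m`, `j : Fin n`
the weight is `(i+j) = (i.1+1)+(j.1+1)`. -/
theorem prop_weakerD3_allpq :
    ∃ C : ℝ, 0 < C ∧
      ∀ p pstar q qstar : ℝ≥0∞,
        1 / p + 1 / pstar = 1 → 1 / q + 1 / qstar = 1 →
        2 ≤ pstar → pstar ≠ ⊤ → 2 ≤ q → q ≠ ⊤ →
        ∀ (m n : ℕ), 0 < m → 0 < n → ∀ A : Fin m → Fin n → ℝ,
          EopNorm p qstar A ≤
            C * (if (3 : ℝ) / 2 ≤ 1 / p.toReal + 1 / qstar.toReal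
                  then max pstar.toReal q.toReal ^ ((3 : ℝ) / 2)
                  else max pstar.toReal q.toReal ^ ((11 : ℝ) / 2)) *
              (Real.sqrt pstar.toReal * D1 pstar A + Real.sqrt q.toReal * D2 q A)
            + C * max pstar.toReal q.toReal *
                (if (3 : ℝ) / 2 ≤ 1 / p.toReal + 1 / qstar.toReal
                  then max pstar.toReal q.toReal ^ ((3 : ℝ) / 2)
                  else max pstar.toReal q.toReal ^ ((11 : ℝ) / 2)) *
                (⨆ ij : Fin m × Fin n,
                  ((ij.1.1 + ij.2.1 + 2 : ℕ) : ℝ) ^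
                      (1 / (8 * max pstar.toReal q.toReal)) * |A ij.1 ij.2|) := by
  have hc := integral_abs_gaussianReal_pos
  set c₀ := ∫ x, |x| ∂(gaussianReal 0 1) with hc₀
  set K : ℝ := 1 + 64000 / c₀ with hKdef
  have hK : 1 ≤ K := by
    have : 0 < 64000 / c₀ := by positivity
    linarith
  have hKc : 64000 ≤ K * c₀ := by
    rw [hKdef, add_mul, one_mul, div_mul_cancel₀ _ hc.ne']
    linarith
  refine ⟨3729 * K, by positivity, ?_⟩
  intro p pstar q qstar hp hq hP hPt hQ hQt m n hm hn A
  obtain ⟨hpt, hpc, hP2⟩ := ENNReal.toReal_holderConjugate_of_one_div_add hp hP hPt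
  obtain ⟨hqt, hqc, hQ2⟩ :=
    ENNReal.toReal_holderConjugate_of_one_div_add (by rwa [add_comm]) hQ hQt
  set M := max pstar.toReal q.toReal with hM
  have hM2 : 2 ≤ M := hP2.trans (le_max_left _ _)
  set β : ℝ := if (3 : ℝ) / 2 ≤ 1 / p.toReal + 1 / qstar.toReal
    then M ^ ((3 : ℝ) / 2) else M ^ ((11 : ℝ) / 2) with hβ
  have hMβ : M ≤ β := by
    rw [hβ]
    split_ifs <;> exact Real.self_le_rpow_of_one_le (by linarith) (by norm_num)
  set T : ℝ := ⨆ ij : Fin m × Fin n,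
    ((ij.1.1 + ij.2.1 + 2 : ℕ) : ℝ) ^ (1 / (8 * M)) * |A ij.1 ij.2| with hT
  have hT0 : 0 ≤ T := Real.iSup_nonneg fun _ => by positivity
  have hlp0 : ∀ {r : ℝ≥0∞} {ι : Type} [Fintype ι] (x : ι → ℝ), r ≠ ⊤ → 0 ≤ _root_.lpNorm r x := by
    intro r ι _ x hr
    rw [_root_.lpNorm, if_neg hr]
    positivity
  have hD10 : 0 ≤ D1 pstar A := Real.iSup_nonneg fun _ => hlp0 _ hPt
  have hD20 : 0 ≤ D2 q A := Real.iSup_nonneg fun _ => hlp0 _ hQt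
  have hTle : ∀ i j, (((i : Fin m) : ℝ) + 1) * (((j : Fin n) : ℝ) + 1) ≤
      ((i.1 + j.1 + 2 : ℕ) : ℝ) ^ (2 : ℝ) := by
    intro i j
    have hi : (0 : ℝ) ≤ (i : ℝ) := Nat.cast_nonneg _
    have hj : (0 : ℝ) ≤ (j : ℝ) := Nat.cast_nonneg _
    push_cast
    rw [Real.rpow_two]
    nlinarith
  have key : ∀ η : ℝ, 0 < η → EopNorm p qstar A ≤ 3 * K * M *
      (6 * (√pstar.toReal * D1 pstar A + √q.toReal * D2 q A) + 1243 * M * (T + η)) := by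
    intro η hη
    refine integral_opNorm_le (u := fun i : Fin m => (i : ℝ) + 1) (v := fun j : Fin n => (j : ℝ) + 1)
      (fun i => by simp) (fun j => by simp) (sum_fin_add_one_rpow_neg_two_le m)
      (sum_fin_add_one_rpow_neg_two_le n) hpt hqt hP2 hQ2 hpc hqc (by positivity) hD10
      hD20 hK hKc (fun i j => ?_) (fun i => ?_) (fun j => ?_)
    · have h1 : ((i.1 + j.1 + 2 : ℕ) : ℝ) ^ (1 / (8 * M)) * |A i j| ≤ T :=
        le_ciSup (f := fun ij : Fin m × Fin n =>
          ((ij.1.1 + ij.2.1 + 2 : ℕ) : ℝ) ^ (1 / (8 * M)) * |A ij.1 ij.2|)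
          (Set.finite_range _).bddAbove (i, j)
      have h2 : (((i : ℝ) + 1) * ((j : ℝ) + 1)) ^ (1 / (16 * M)) ≤
          ((i.1 + j.1 + 2 : ℕ) : ℝ) ^ (1 / (8 * M)) := by
        calc _ ≤ (((i.1 + j.1 + 2 : ℕ) : ℝ) ^ (2 : ℝ)) ^ (1 / (16 * M)) :=
              Real.rpow_le_rpow (by positivity) (hTle i j) (by positivity)
          _ = _ := by
              rw [← Real.rpow_mul (by positivity)]
              congr 1
              field_simp
              norm_num
      calc _ ≤ ((i.1 + j.1 + 2 : ℕ) : ℝ) ^ (1 / (8 * M)) * |A i j| := by gcongr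
        _ ≤ T + η := by linarith
    · exact sum_rpow_le_rpow_of_lpNorm_le hPt (by linarith)
        (le_ciSup (f := fun i => _root_.lpNorm pstar fun j => A i j) (Set.finite_range _).bddAbove i)
    · exact sum_rpow_le_rpow_of_lpNorm_le hQt (by linarith)
        (le_ciSup (f := fun j => _root_.lpNorm q fun i => A i j) (Set.finite_range _).bddAbove j)
  set S := √pstar.toReal * D1 pstar A + √q.toReal * D2 q A with hS
  have hS0 : 0 ≤ S := by positivity
  have hlim : EopNorm p qstar A ≤ 3 * K * M * (6 * S + 1243 * M * T) := by
    refine le_of_forall_pos_le_add fun δ hδ => ?_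
    refine (key (δ / (3729 * K * M * M)) (by positivity)).trans (le_of_eq ?_)
    field_simp
    ring
  have e1 : K * M * S ≤ K * β * S := by gcongr
  have e2 : K * M * M * T ≤ K * M * β * T := by gcongr
  have e3 : 0 ≤ K * β * S := by positivity
  linarith
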